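/- Let p be a prime, k ≥ 3 an integer, 0 < ε < 1, and δ = ε^{C_{p,k}}. Let n be a positive integer and X_1,…,X_k ⊆ F_p^n be such that there is a collection of at least εN pairwise disjoint k-cycles in X_1×⋯×X_k. Then the total number of k-cycles (x_1,…,x_k) ∈ X_1×⋯×X_k is at least δ N^{k−1}. -/

import Mathlib

open scoped Classical

/-- The set of k-cycles in X 0 x ... x X (k-1): tuples with i-th coordinate in X i
summing to zero. -/
noncomputable def cycleSet {V : Type} [AddCommGroup V] [Fintype V] (k : ℕ)
    (X : Fin k → Finset V) : Finset (Fin k → V) :=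
  (Fintype.piFinset X).filter fun x => ∑ i, x i = 0

/-- The constant c_{p,3} ∈ (0,1), defined by
inf_{0<t<1} (t^0 + ... + t^(p-1)) / t^((p-1)/3) = p^(1 - c_{p,3}). -/
noncomputable def cp3 (p : ℕ) : ℝ :=
  1 - Real.logb p (sInf ((fun t : ℝ =>
    (∑ j ∈ Finset.range p, t ^ j) / t ^ (((p : ℝ) - 1) / 3)) '' Set.Ioo 0 1))

/-- The constant C_{p,k} = (k-2)/c_{p,3} + 1. -/
noncomputable def Cconst (p k : ℕ) : ℝ := ((k : ℝ) - 2) / cp3 p + 1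

/-- A subspace of `I → F` contains a vector whose support is at least its dimension. -/
lemma exists_finrank_le_card_support {F I : Type*} [Field F] [Fintype I]
    (W : Submodule F (I → F)) :
    ∃ h ∈ W, Module.finrank F W ≤ (Finset.univ.filter fun i => h i ≠ 0).card := by
  let s : (I → F) → ℕ := fun h => (Finset.univ.filter fun i => h i ≠ 0).card
  have hfin : (s '' (W : Set (I → F))).Finite :=
    (Set.finite_Iic (Fintype.card I)).subset (by
      rintro _ ⟨h, -, rfl⟩
      exact Finset.card_le_univ _)
  obtain ⟨h, hW, hmax⟩ : ∃ h ∈ W, ∀ h' ∈ W, s h' ≤ s h := by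
    obtain ⟨_, ⟨h, hW, rfl⟩, hm⟩ := Set.exists_max_image _ id hfin ⟨_, 0, W.zero_mem, rfl⟩
    exact ⟨h, hW, fun h' hh' => hm _ ⟨h', hh', rfl⟩⟩
  refine ⟨h, hW, ?_⟩
  by_contra! hlt
  let S := {i // h i ≠ 0}
  let φ : W →ₗ[F] (S → F) :=
    (LinearMap.funLeft F F (fun i : S => (i : I))).comp W.subtype
  have hcard : Module.finrank F (S → F) < Module.finrank F W := by
    rw [Module.finrank_fintype_fun_eq_card, Fintype.card_subtype]
    exact hlt
  obtain ⟨w, hw, hw0⟩ := (LinearMap.ker φ).ne_bot_iff.mp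
    (LinearMap.ker_ne_bot_of_finrank_lt hcard)
  have hwS : ∀ i, h i ≠ 0 → (w : I → F) i = 0 := fun i hi =>
    congrFun (LinearMap.mem_ker.mp hw) ⟨i, hi⟩
  obtain ⟨j, hj⟩ : ∃ j, (w : I → F) j ≠ 0 := by
    by_contra! hall
    exact hw0 (Subtype.ext (funext hall))
  refine absurd (hmax _ (W.add_mem hW w.2)) (not_le.mpr (Finset.card_lt_card ?_))
  rw [Finset.ssubset_iff_of_subset]
  · refine ⟨j, ?_, ?_⟩
    · have : h j = 0 := by
        by_contra hh
        exact hj (hwS j hh)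
      simp [this, hj]
    · have : h j = 0 := by
        by_contra hh
        exact hj (hwS j hh)
      simp [this]
  · intro i hi
    simp only [Finset.mem_filter, Finset.mem_univ, true_and] at hi ⊢
    simpa [hwS i hi] using hi

lemma matrix_rank_add_le {F I J : Type*} [Field F] [Fintype I] [Fintype J] (M M' : Matrix I J F) :
    (M + M').rank ≤ M.rank + M'.rank := by
  unfold Matrix.rank
  refine (Submodule.finrank_mono ?_).trans (Submodule.finrank_add_le_finrank_add_finrank _ _)
  rintro _ ⟨v, rfl⟩
  rw [Matrix.mulVecLin_add]
  exact Submodule.add_mem_sup ⟨v, rfl⟩ ⟨v, rfl⟩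

/-- A matrix which is a sum of rank one matrices whose left factors come from a family of
size `r` has rank at most `r`. -/
lemma rank_le_of_factor {F I E Ω : Type*} [Field F] [Fintype I]
    (L : Finset E) (Ω' : Finset Ω) (g : Ω → E) (hg : ∀ ω ∈ Ω', g ω ∈ L)
    (B : E → I → F) (C : Ω → I → F) :
    (Matrix.of fun j k => ∑ ω ∈ Ω', B (g ω) j * C ω k).rank ≤ L.card := by
  have : (Matrix.of fun j k => ∑ ω ∈ Ω', B (g ω) j * C ω k) =
      (Matrix.of fun (j : I) (β : L) => B β j) *
        (Matrix.of fun (β : L) (k : I) => ∑ ω ∈ Ω' with g ω = β, C ω k) := by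
    ext j k
    simp only [Matrix.of_apply, Matrix.mul_apply]
    rw [Finset.sum_coe_sort L (fun β => B β j * ∑ ω ∈ Ω' with g ω = β, C ω k),
      ← Finset.sum_fiberwise_of_maps_to hg]
    refine Finset.sum_congr rfl fun β _ => ?_
    rw [Finset.mul_sum]
    refine Finset.sum_congr rfl fun ω hω => ?_
    rw [(Finset.mem_filter.mp hω).2]
  rw [this]
  calc _ ≤ _ := Matrix.rank_mul_le_left _ _
    _ ≤ Fintype.card L := Matrix.rank_le_card_width _
    _ = L.card := Fintype.card_coe L

/-- The slice rank bound for the diagonal tensor. -/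
lemma card_le_three_mul_of_slices {F I E Ω : Type*} [Field F] [Fintype I]
    (L : Finset E) (Ω' : Finset Ω) (f g h : Ω → E)
    (hL : ∀ ω ∈ Ω', f ω ∈ L ∨ g ω ∈ L ∨ h ω ∈ L) (c : Ω → F) (A B C : E → I → F)
    (hδ : ∀ i j k, (if i = j ∧ j = k then (1 : F) else 0) =
      ∑ ω ∈ Ω', c ω * A (f ω) i * B (g ω) j * C (h ω) k) :
    Fintype.card I ≤ 3 * L.card := by
  let φ : (I → F) →ₗ[F] (L → F) := Matrix.mulVecLin (Matrix.of fun (β : L) i => A β i)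
  obtain ⟨v, hv, hsupp⟩ := exists_finrank_le_card_support (LinearMap.ker φ)
  have hdim : Fintype.card I ≤ L.card + Module.finrank F (LinearMap.ker φ) := by
    have h1 := LinearMap.finrank_range_add_finrank_ker φ
    have h2 := Submodule.finrank_le (LinearMap.range φ)
    rw [Module.finrank_fintype_fun_eq_card] at h1 h2
    rw [Fintype.card_coe] at h2
    omega
  have hv' : ∀ β ∈ L, ∑ i, A β i * v i = 0 := fun β hβ =>
    congrFun (LinearMap.mem_ker.mp hv) ⟨β, hβ⟩
  have hdiag : Matrix.diagonal v =
      (Matrix.of fun j k => ∑ ω ∈ Ω' with f ω ∉ L ∧ g ω ∈ L,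
        B (g ω) j * (c ω * (∑ i, A (f ω) i * v i) * C (h ω) k)) +
      (Matrix.of fun k j => ∑ ω ∈ Ω' with f ω ∉ L ∧ g ω ∉ L,
        C (h ω) k * (c ω * (∑ i, A (f ω) i * v i) * B (g ω) j)).transpose := by
    ext j k
    have h1 : Matrix.diagonal v j k = ∑ i, v i * (if i = j ∧ j = k then (1 : F) else 0) := by
      rw [Matrix.diagonal_apply]
      by_cases hjk : j = k <;> simp [hjk]
    have h2 : ∀ ω, ∑ i, v i * (c ω * A (f ω) i * B (g ω) j * C (h ω) k) =
        c ω * (∑ i, A (f ω) i * v i) * B (g ω) j * C (h ω) k := fun ω => by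
      rw [Finset.mul_sum, Finset.sum_mul, Finset.sum_mul]
      exact Finset.sum_congr rfl fun i _ => by ring
    have h3 : ∑ i, v i * (if i = j ∧ j = k then (1 : F) else 0) =
        ∑ ω ∈ Ω', c ω * (∑ i, A (f ω) i * v i) * B (g ω) j * C (h ω) k := by
      rw [← Finset.sum_congr rfl fun ω _ => h2 ω, Finset.sum_comm]
      exact Finset.sum_congr rfl fun i _ => by rw [hδ, Finset.mul_sum]
    simp only [h1, h3, Matrix.add_apply, Matrix.transpose_apply, Matrix.of_apply]
    rw [← Finset.sum_filter_add_sum_filter_not Ω' (fun ω => f ω ∈ L),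
      Finset.sum_eq_zero, zero_add,
      ← Finset.sum_filter_add_sum_filter_not _ (fun ω => g ω ∈ L),
      Finset.filter_filter, Finset.filter_filter]
    · congr 1 <;> exact Finset.sum_congr rfl fun ω _ => by ring
    · intro ω hω
      rw [hv' _ (Finset.mem_filter.mp hω).2]
      ring
  have hrank : (Finset.univ.filter fun i => v i ≠ 0).card ≤ L.card + L.card := by
    have h1 : (Matrix.diagonal v).rank = (Finset.univ.filter fun i => v i ≠ 0).card := by
      rw [Matrix.rank_diagonal, Fintype.card_subtype]
    rw [← h1, hdiag]
    refine (matrix_rank_add_le _ _).trans (add_le_add ?_ ?_)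
    · exact rank_le_of_factor L _ g (fun ω hω => (Finset.mem_filter.mp hω).2.2) B _
    · rw [Matrix.rank_transpose]
      refine rank_le_of_factor L _ h (fun ω hω => ?_) C _
      have h3 := Finset.mem_filter.mp hω
      have := hL ω h3.1
      tauto
  omega

/-- The exponent vectors of monomials of degree at most a third of the maximum. -/
noncomputable def lowExponents (p e : ℕ) : Finset (Fin e → ℕ) :=
  (Fintype.piFinset fun _ => Finset.range p).filter fun α => 3 * ∑ l, α l ≤ e * (p - 1)

lemma exists_expansion (p : ℕ) [hp : Fact p.Prime] :
    ∃ (J : Finset (Fin 3 → ℕ)) (coef : (Fin 3 → ℕ) → ZMod p),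
      (∀ w ∈ J, ∑ i, w i ≤ p - 1) ∧
      ∀ u : Fin 3 → ZMod p, 1 - (∑ i, u i) ^ (p - 1) = ∑ w ∈ J, coef w * ∏ i, u i ^ w i := by
  have hp1 : p - 1 ≠ 0 := (Nat.sub_pos_of_lt hp.out.one_lt).ne'
  have h0 : (0 : Fin 3 → ℕ) ∉ Finset.univ.piAntidiag (p - 1) := by
    rw [Finset.mem_piAntidiag]
    rintro ⟨h, -⟩
    exact hp1 (by simpa using h.symm)
  refine ⟨insert 0 (Finset.univ.piAntidiag (p - 1)),
    fun w => if w = 0 then 1 else -(Nat.multinomial Finset.univ w : ZMod p), ?_, ?_⟩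
  · intro w hw
    rcases Finset.mem_insert.mp hw with rfl | hw
    · simp
    · exact (Finset.mem_piAntidiag.mp hw).1.le
  · intro u
    rw [Finset.sum_insert h0, Finset.sum_pow_eq_sum_piAntidiag, sub_eq_add_neg,
      ← Finset.sum_neg_distrib]
    congr 1
    · simp
    · refine Finset.sum_congr rfl fun w hw => ?_
      beta_reduce
      rw [if_neg (fun h : w = 0 => h0 (h ▸ hw)), neg_mul]

lemma prod_one_sub_pow_eq_ite {p : ℕ} [hp : Fact p.Prime] {e : ℕ} (v : Fin e → ZMod p) :
    ∏ l, (1 - v l ^ (p - 1)) = if v = 0 then 1 else 0 := by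
  have hp1 : p - 1 ≠ 0 := (Nat.sub_pos_of_lt hp.out.one_lt).ne'
  split_ifs with h
  · simp [h, hp1]
  · obtain ⟨l, hl⟩ := Function.ne_iff.mp h
    refine Finset.prod_eq_zero (Finset.mem_univ l) ?_
    rw [ZMod.pow_card_sub_one_eq_one hl, sub_self]

/-- A tri-coloured sum-free family in `F_p^e` is at most three times as large as the number of
low degree monomials. -/
lemma card_le_three_mul_lowExponents {p : ℕ} [hp : Fact p.Prime] {e : ℕ} {I : Type*} [Fintype I]
    (x : Fin 3 → I → Fin e → ZMod p)
    (hx : ∀ i j k, x 0 i + x 1 j + x 2 k = 0 ↔ i = j ∧ j = k) :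
    Fintype.card I ≤ 3 * (lowExponents p e).card := by
  obtain ⟨J, coef, hJ, hcoef⟩ := exists_expansion p
  refine card_le_three_mul_of_slices (F := ZMod p) (lowExponents p e)
    (Fintype.piFinset fun _ : Fin e => J)
    (fun ω l => ω l 0) (fun ω l => ω l 1) (fun ω l => ω l 2) ?_ (fun ω => ∏ l, coef (ω l))
    (fun α i => ∏ l, x 0 i l ^ α l) (fun α i => ∏ l, x 1 i l ^ α l)
    (fun α i => ∏ l, x 2 i l ^ α l) ?_
  · intro ω hω
    rw [Fintype.mem_piFinset] at hω
    have hle : ∀ l, ω l 0 + ω l 1 + ω l 2 ≤ p - 1 := fun l => by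
      have := hJ _ (hω l)
      rwa [Fin.sum_univ_three] at this
    have hlt : ∀ l, ∀ i : Fin 3, ω l i < p := fun l i => by
      have h1 := hle l
      have h2 := hp.out.one_lt
      fin_cases i <;> simp <;> omega
    have hsum : ∑ l, ω l 0 + ∑ l, ω l 1 + ∑ l, ω l 2 ≤ e * (p - 1) := by
      rw [← Finset.sum_add_distrib, ← Finset.sum_add_distrib]
      refine (Finset.sum_le_sum fun l _ => hle l).trans ?_
      simp
    simp only [lowExponents, Finset.mem_filter, Fintype.mem_piFinset, Finset.mem_range, hlt,
      implies_true, true_and]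
    omega
  · intro i j k
    have h1 : (if i = j ∧ j = k then (1 : ZMod p) else 0) =
        ∏ l, (1 - (∑ c, ![x 0 i, x 1 j, x 2 k] c l) ^ (p - 1)) := by
      rw [prod_one_sub_pow_eq_ite (fun l => ∑ c, ![x 0 i, x 1 j, x 2 k] c l)]
      refine if_congr ?_ rfl rfl
      rw [← hx]
      simp [funext_iff, Fin.sum_univ_three]
    rw [h1]
    simp only [hcoef]
    rw [Finset.prod_univ_sum]
    refine Finset.sum_congr rfl fun ω _ => ?_
    simp only [Finset.prod_mul_distrib, Fin.prod_univ_three]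
    simp [mul_assoc]

lemma card_lowExponents_le {p : ℕ} [hp : Fact p.Prime] (e : ℕ) {t : ℝ} (ht0 : 0 < t)
    (ht1 : t < 1) :
    ((lowExponents p e).card : ℝ) ≤
      ((∑ j ∈ Finset.range p, t ^ j) / t ^ (((p : ℝ) - 1) / 3)) ^ e := by
  have hpow : (t ^ (((p : ℝ) - 1) / 3)) ^ e = t ^ (((e * (p - 1) : ℕ) : ℝ) / 3) := by
    rw [← Real.rpow_natCast, ← Real.rpow_mul ht0.le]
    congr 1
    rw [Nat.cast_mul, Nat.cast_sub hp.out.one_lt.le]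
    push_cast
    ring
  have hpos : 0 < t ^ (((e * (p - 1) : ℕ) : ℝ) / 3) := Real.rpow_pos_of_pos ht0 _
  rw [div_pow, hpow, le_div_iff₀ hpos, ← nsmul_eq_mul, Finset.sum_pow', ← Finset.sum_const]
  calc _ ≤ ∑ α ∈ lowExponents p e, ∏ l, t ^ α l := by
        refine Finset.sum_le_sum fun α hα => ?_
        rw [Finset.prod_pow_eq_pow_sum, ← Real.rpow_natCast]
        refine Real.rpow_le_rpow_of_exponent_ge ht0 ht1.le ?_
        rw [le_div_iff₀ (by norm_num)]
        have := (Finset.mem_filter.mp hα).2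
        rw [mul_comm]
        exact_mod_cast this
    _ ≤ _ := Finset.sum_le_sum_of_subset_of_nonneg (Finset.filter_subset _ _)
        fun _ _ _ => Finset.prod_nonneg fun _ _ => by positivity

/-- The infimum appearing in the definition of `cp3`. -/
noncomputable def cp3Inf (p : ℕ) : ℝ :=
  sInf ((fun t : ℝ =>
    (∑ j ∈ Finset.range p, t ^ j) / t ^ (((p : ℝ) - 1) / 3)) '' Set.Ioo 0 1)

lemma one_le_cp3_summand {p : ℕ} (hp : 1 ≤ p) {t : ℝ} (ht0 : 0 < t) (ht1 : t < 1) :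
    1 ≤ (∑ j ∈ Finset.range p, t ^ j) / t ^ (((p : ℝ) - 1) / 3) := by
  have hp' : (1 : ℝ) ≤ p := by exact_mod_cast hp
  rw [le_div_iff₀ (Real.rpow_pos_of_pos ht0 _), one_mul]
  refine (Real.rpow_le_one ht0.le ht1.le (by linarith)).trans ?_
  have := Finset.single_le_sum (f := fun j => t ^ j) (s := Finset.range p)
    (fun j _ => by positivity) (Finset.mem_range.mpr hp)
  simpa using this

lemma one_le_cp3Inf {p : ℕ} (hp : 1 ≤ p) : 1 ≤ cp3Inf p := by
  refine le_csInf ⟨_, 1 / 2, by norm_num, rfl⟩ ?_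
  rintro _ ⟨t, ⟨ht0, ht1⟩, rfl⟩
  exact one_le_cp3_summand hp ht0 ht1

lemma bddBelow_cp3 {p : ℕ} (hp : 1 ≤ p) : BddBelow ((fun t : ℝ =>
    (∑ j ∈ Finset.range p, t ^ j) / t ^ (((p : ℝ) - 1) / 3)) '' Set.Ioo 0 1) := by
  refine ⟨1, ?_⟩
  rintro _ ⟨t, ⟨ht0, ht1⟩, rfl⟩
  exact one_le_cp3_summand hp ht0 ht1

lemma cp3Inf_lt {p : ℕ} (hp : 2 ≤ p) : cp3Inf p < p := by
  have hp' : (2 : ℝ) ≤ p := by exact_mod_cast hp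
  let F : ℝ → ℝ := fun t => (∑ j ∈ Finset.range p, t ^ j) - p * t ^ (((p : ℝ) - 1) / 3)
  have hsum : ∑ j ∈ Finset.range p, (j : ℝ) = p * (p - 1) / 2 := by
    have := Finset.sum_range_id_mul_two p
    have h2 : ((∑ j ∈ Finset.range p, j : ℕ) : ℝ) * 2 = p * (p - 1 : ℕ) := by exact_mod_cast this
    rw [Nat.cast_sub (by omega)] at h2
    push_cast at h2
    linarith
  have hder : HasDerivAt F (p * (p - 1) / 6) 1 := by
    have h1 : HasDerivAt (fun t : ℝ => ∑ j ∈ Finset.range p, t ^ j)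
        (∑ j ∈ Finset.range p, (j : ℝ) * 1 ^ (j - 1)) 1 :=
      HasDerivAt.fun_sum fun j _ => hasDerivAt_pow j 1
    have h2 : HasDerivAt (fun t : ℝ => t ^ (((p : ℝ) - 1) / 3))
        (((p : ℝ) - 1) / 3 * 1 ^ (((p : ℝ) - 1) / 3 - 1)) 1 :=
      Real.hasDerivAt_rpow_const (Or.inl one_ne_zero)
    have h3 := h1.sub (h2.const_mul (p : ℝ))
    refine h3.congr_deriv ?_
    simp only [one_pow, mul_one, Real.one_rpow, hsum]
    ring
  have hF1 : F 1 = 0 := by simp [F]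
  have hpos : (0 : ℝ) < p * (p - 1) / 6 := by
    have : (0 : ℝ) < p * (p - 1) := mul_pos (by linarith) (by linarith)
    linarith
  obtain ⟨t, ht0, ht1, ht⟩ : ∃ t : ℝ, 0 < t ∧ t < 1 ∧ F t < 0 := by
    have hslope := hasDerivAt_iff_tendsto_slope.mp hder
    have hev := (hslope.mono_left (nhdsWithin_mono 1
      (fun x (hx : x ∈ Set.Iio (1 : ℝ)) => ne_of_lt hx))).eventually (lt_mem_nhds hpos)
    have hI : ∀ᶠ t in nhdsWithin (1 : ℝ) (Set.Iio 1), t ∈ Set.Ioo (0 : ℝ) 1 :=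
      Ioo_mem_nhdsLT one_pos
    obtain ⟨t, h1, h2⟩ := (hev.and hI).exists
    refine ⟨t, h2.1, h2.2, ?_⟩
    rw [slope_def_field, hF1, sub_zero] at h1
    by_contra! hge
    exact absurd (div_nonpos_of_nonneg_of_nonpos hge (by linarith [h2.2])) (not_le.mpr h1)
  refine (csInf_le (bddBelow_cp3 (by omega)) ⟨t, ⟨ht0, ht1⟩, rfl⟩).trans_lt ?_
  rw [div_lt_iff₀ (Real.rpow_pos_of_pos ht0 _)]
  simp only [F] at ht
  linarith

lemma cp3_pos {p : ℕ} (hp : 2 ≤ p) : 0 < cp3 p := by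
  have hp' : (1 : ℝ) < p := by exact_mod_cast hp
  have h := Real.logb_lt_logb hp' (zero_lt_one.trans_le (one_le_cp3Inf (by omega)))
    (cp3Inf_lt hp)
  rw [Real.logb_self_eq_one hp'] at h
  have : cp3 p = 1 - Real.logb p (cp3Inf p) := rfl
  linarith

lemma cp3Inf_eq {p : ℕ} (hp : 2 ≤ p) : cp3Inf p = (p : ℝ) ^ (1 - cp3 p) := by
  have hp' : (1 : ℝ) < p := by exact_mod_cast hp
  have : 1 - cp3 p = Real.logb p (cp3Inf p) := by
    unfold cp3 cp3Inf
    ring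
  rw [this, Real.rpow_logb (by linarith) hp'.ne'
    (zero_lt_one.trans_le (one_le_cp3Inf (by omega)))]

/-- The upper bound for tri-coloured sum-free families in `F_p^e`. -/
theorem card_sumFree_le {p : ℕ} [hp : Fact p.Prime] {e : ℕ} {I : Type*} [Fintype I]
    (x : Fin 3 → I → Fin e → ZMod p)
    (hx : ∀ i j k, x 0 i + x 1 j + x 2 k = 0 ↔ i = j ∧ j = k) :
    (Fintype.card I : ℝ) ≤ 3 * ((p : ℝ) ^ e) ^ (1 - cp3 p) := by
  have hp2 := hp.out.two_le
  have h1 : (Fintype.card I : ℝ) ≤ 3 * (lowExponents p e).card := by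
    exact_mod_cast card_le_three_mul_lowExponents x hx
  refine h1.trans (mul_le_mul_of_nonneg_left ?_ (by norm_num))
  rw [← Real.rpow_natCast, ← Real.rpow_mul (by positivity), mul_comm, Real.rpow_mul (by positivity),
    ← cp3Inf_eq hp2, Real.rpow_natCast]
  rcases Nat.eq_zero_or_pos e with rfl | he
  · have := card_lowExponents_le (p := p) 0 (t := 1 / 2) (by norm_num) (by norm_num)
    simpa using this
  · refine le_of_forall_gt_imp_ge_of_dense fun b hb => ?_
    have hI0 := zero_lt_one.trans_le (one_le_cp3Inf (p := p) (by omega))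
    have hb0 : 0 < b := (pow_pos hI0 e).trans hb
    have hlt : cp3Inf p < b ^ ((e : ℝ)⁻¹) := by
      refine lt_of_pow_lt_pow_left₀ e (by positivity) ?_
      rwa [Real.rpow_inv_natCast_pow hb0.le he.ne']
    obtain ⟨_, ⟨t, ⟨ht0, ht1⟩, rfl⟩, ht⟩ := exists_lt_of_csInf_lt
      ((Set.nonempty_Ioo.mpr zero_lt_one).image _) hlt
    refine (card_lowExponents_le e ht0 ht1).trans ?_
    rw [← Real.rpow_inv_natCast_pow hb0.le he.ne']
    exact pow_le_pow_left₀ (zero_le_one.trans (one_le_cp3_summand (by omega) ht0 ht1)) ht.le e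

/-- The zero-sum tuples in `∏ i, X i`, for an arbitrary finite index type. -/
noncomputable def cycles {ι V : Type*} [Fintype ι] [DecidableEq ι] [AddCommGroup V]
    (X : ι → Finset V) : Finset (ι → V) :=
  (Fintype.piFinset X).filter fun x => ∑ i, x i = 0

/-- Distinct tuples in `D` differ in every coordinate. -/
def PairwiseApart {ι V : Type*} (D : Finset (ι → V)) : Prop :=
  ∀ c ∈ D, ∀ c' ∈ D, c ≠ c' → ∀ i, c i ≠ c' i

section
variable {ι V : Type*} [Fintype ι] [DecidableEq ι] [AddCommGroup V]

lemma mem_cycles {X : ι → Finset V} {x : ι → V} :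
    x ∈ cycles X ↔ (∀ i, x i ∈ X i) ∧ ∑ i, x i = 0 := by
  simp [cycles]

lemma card_cycles_univ_mul [Fintype V] [Nonempty ι] :
    (cycles fun _ : ι => (Finset.univ : Finset V)).card * Fintype.card V =
      Fintype.card V ^ Fintype.card ι := by
  obtain ⟨i₀⟩ := ‹Nonempty ι›
  have hfib : ∀ s : V, (Finset.univ.filter fun x : ι → V => ∑ i, x i = s).card =
      (cycles fun _ : ι => (Finset.univ : Finset V)).card := fun s => by
    refine Finset.card_bij' (fun x _ => x - Pi.single i₀ s) (fun x _ => x + Pi.single i₀ s)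
      ?_ ?_ (by simp) (by simp)
    · intro x hx
      simp only [Finset.mem_filter, Finset.mem_univ, true_and] at hx
      simp [mem_cycles, Finset.sum_sub_distrib, hx]
    · intro x hx
      have := (mem_cycles.mp hx).2
      simp [Finset.sum_add_distrib, this]
  have h := Finset.card_eq_sum_card_fiberwise (s := (Finset.univ : Finset (ι → V)))
    (t := (Finset.univ : Finset V)) (f := fun x => ∑ i, x i) (fun _ _ => Finset.mem_univ _)
  simp only [hfib, Finset.sum_const, Finset.card_univ, Fintype.card_fun, smul_eq_mul] at h
  rw [h, mul_comm]

end

/-- The linear group acts transitively on nonzero vectors. -/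
lemma exists_linearEquiv_apply_eq {K V : Type*} [Field K] [AddCommGroup V] [Module K V]
    {v w : V} (hv : v ≠ 0) (hw : w ≠ 0) : ∃ g : V ≃ₗ[K] V, g v = w := by
  obtain ⟨g, hg⟩ := Submodule.exists_linearEquiv_restrict_eq
    ((LinearEquiv.toSpanNonzeroSingleton K V v hv).symm ≪≫ₗ
      LinearEquiv.toSpanNonzeroSingleton K V w hw)
  refine ⟨g, ?_⟩
  have h1 := hg ⟨v, Submodule.mem_span_singleton_self v⟩
  have h2 : (LinearEquiv.toSpanNonzeroSingleton K V v hv).symm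
      ⟨v, Submodule.mem_span_singleton_self v⟩ = 1 := by
    rw [LinearEquiv.symm_apply_eq]
    exact (LinearEquiv.toSpanNonzeroSingleton_one K V v hv).symm
  rw [LinearEquiv.trans_apply, h2, LinearEquiv.toSpanNonzeroSingleton_one] at h1
  exact h1.symm

section
variable {K U V : Type*} [Field K] [AddCommGroup U] [Module K U] [Fintype U]
  [AddCommGroup V] [Module K V] [Fintype V]

instance finite_linearMap_of_finite : Finite (U →ₗ[K] V) :=
  Finite.of_injective (fun L => (L : U → V)) DFunLike.coe_injective

variable (K U V) in
/-- The injective linear maps between two finite vector spaces. -/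
noncomputable def injLinearMaps : Finset (U →ₗ[K] V) :=
  (Set.toFinite {L : U →ₗ[K] V | Function.Injective L}).toFinset

lemma mem_injLinearMaps {L : U →ₗ[K] V} : L ∈ injLinearMaps K U V ↔ Function.Injective L := by
  simp [injLinearMaps]

lemma card_filter_mem_range {L : U →ₗ[K] V} (hL : Function.Injective L) :
    (Finset.univ.filter fun v => v ∈ LinearMap.range L).card = Fintype.card U := by
  rw [← Finset.card_univ, ← Finset.card_image_of_injective _ hL]
  congr 1
  ext v
  simp

lemma card_filter_mem_range_mul_le {v : V} (hv : v ≠ 0) :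
    ((injLinearMaps K U V).filter fun L => v ∈ LinearMap.range L).card * Fintype.card V ≤
      (injLinearMaps K U V).card * Fintype.card U := by
  set I := injLinearMaps K U V with hI
  set A : V → ℕ := fun v => (I.filter fun L => v ∈ LinearMap.range L).card with hA
  have hle : ∀ w, w ≠ 0 → A v ≤ A w := fun w hw => by
    obtain ⟨g, hg⟩ := exists_linearEquiv_apply_eq (K := K) hv hw
    refine Finset.card_le_card_of_injOn (fun L => (g : V →ₗ[K] V).comp L) ?_ ?_
    · intro L hL
      simp only [Finset.coe_filter, Set.mem_ofPred_eq, hI, mem_injLinearMaps] at hL ⊢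
      obtain ⟨hL, u, hu⟩ := hL
      exact ⟨g.injective.comp hL, u, by simp [hu, hg]⟩
    · intro L _ L' _ h
      ext u
      exact g.injective (LinearMap.congr_fun h u)
  have hdouble : ∑ w ∈ Finset.univ.erase (0 : V), A w = ∑ L ∈ I, (Fintype.card U - 1) := by
    simp only [hA, Finset.card_filter]
    rw [Finset.sum_comm]
    refine Finset.sum_congr rfl fun L hL => ?_
    rw [← Finset.card_filter, ← card_filter_mem_range (mem_injLinearMaps.mp hL),
      ← Finset.card_erase_of_mem (a := (0 : V)) (by simpa using ⟨0, map_zero L⟩)]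
    congr 1
    ext w
    simp [and_comm]
  have hmul : (Fintype.card V - 1) * A v ≤ I.card * (Fintype.card U - 1) := by
    rw [← smul_eq_mul I.card, ← Finset.sum_const, ← hdouble, ← Finset.card_univ,
      ← Finset.card_erase_of_mem (Finset.mem_univ (0 : V)), ← smul_eq_mul, ← Finset.sum_const]
    exact Finset.sum_le_sum fun w hw => hle w (Finset.ne_of_mem_erase hw)
  have hAI : A v ≤ I.card := Finset.card_filter_le _ _
  have hU : 1 ≤ Fintype.card U := Fintype.card_pos
  have hV : 1 ≤ Fintype.card V := Fintype.card_pos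
  obtain ⟨a, ha⟩ := Nat.exists_eq_add_of_le hU
  obtain ⟨b, hb⟩ := Nat.exists_eq_add_of_le hV
  rw [ha, hb] at hmul ⊢
  simp only [Nat.add_sub_cancel_left] at hmul
  change A v * _ ≤ _
  nlinarith

/-- The number of zero-sum translations which move a given zero-sum tuple into the range of an
injective linear map. -/
lemma card_translations_eq {ι : Type*} [Fintype ι] [DecidableEq ι] {L : U →ₗ[K] V}
    (hL : Function.Injective L) {t : ι → V} (ht : ∑ i, t i = 0) :
    ((cycles fun _ : ι => (Finset.univ : Finset V)).filter
      fun h => ∀ i, t i + h i ∈ LinearMap.range L).card =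
      (cycles fun _ : ι => (Finset.univ : Finset U)).card := by
  symm
  refine Finset.card_bij (fun u _ i => L (u i) - t i) ?_ ?_ ?_
  · intro u hu
    have hu := (mem_cycles.mp hu).2
    simp [mem_cycles, Finset.sum_sub_distrib, ht, ← map_sum, hu]
  · intro u _ u' _ h
    funext i
    have := congrFun h i
    exact hL (by simpa using this)
  · intro h hh
    obtain ⟨h1, h2⟩ := Finset.mem_filter.mp hh
    choose u hu using h2
    refine ⟨u, ?_, ?_⟩
    · rw [mem_cycles]
      refine ⟨by simp, hL ?_⟩
      rw [map_sum, map_zero]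
      simp [hu, Finset.sum_add_distrib, ht, (mem_cycles.mp h1).2]
    · funext i
      simp [hu]

/-- The cycles `t` moved by the translation `h` into the range of `L` and sharing no vertex with
any other such cycle. -/
noncomputable def isolatedCycles {ι : Type*} (T : Finset (ι → V)) (L : U →ₗ[K] V) (h : ι → V) :
    Finset (ι → V) :=
  T.filter fun t => (∀ i, t i + h i ∈ LinearMap.range L) ∧
    ∀ t' ∈ T, (∀ i, t' i + h i ∈ LinearMap.range L) → (∃ i, t' i = t i) → t' = t

lemma exists_card_isolatedCycles {ι : Type*} [Fintype ι] [DecidableEq ι] [Nonempty ι]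
    (X : ι → Finset V) {Δ : ℝ}
    (hΔ : ∀ i v, (((cycles X).filter fun t => t i = v).card : ℝ) ≤ Δ)
    (hne : (injLinearMaps K U V).Nonempty) {B : ℝ}
    (hB : ∀ L ∈ injLinearMaps K U V, ∀ h : ι → V, ∑ i, h i = 0 →
      ((isolatedCycles (cycles X) L h).card : ℝ) ≤ B) :
    ((cycles X).card : ℝ) * (cycles fun _ : ι => (Finset.univ : Finset U)).card *
      (1 - Fintype.card ι * Δ * Fintype.card U / Fintype.card V) ≤
      (cycles fun _ : ι => (Finset.univ : Finset V)).card * B := by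
  set T := cycles X with hT
  set I := injLinearMaps K U V with hI
  set ZV := cycles fun _ : ι => (Finset.univ : Finset V) with hZV
  set ZU := cycles fun _ : ι => (Finset.univ : Finset U) with hZU
  let surv : (U →ₗ[K] V) → (ι → V) → (ι → V) → Prop := fun L h t =>
    ∀ i, t i + h i ∈ LinearMap.range L
  let near : Finset ((ι → V) × (ι → V)) :=
    (T ×ˢ T).filter fun q => q.2 ≠ q.1 ∧ ∃ i, q.2 i = q.1 i
  have hV : (0 : ℝ) < Fintype.card V := by exact_mod_cast Fintype.card_pos
  have hI0 : (0 : ℝ) < I.card := by exact_mod_cast hne.card_pos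
  have hpt : ∀ L h, (T.filter fun t => surv L h t).card ≤ (isolatedCycles T L h).card +
      (near.filter fun q => surv L h q.1 ∧ surv L h q.2).card := fun L h => by
    have hsub : (T.filter fun t => surv L h t) ⊆ isolatedCycles T L h ∪
        (near.filter fun q => surv L h q.1 ∧ surv L h q.2).image Prod.fst := by
      intro t ht
      obtain ⟨htT, hts⟩ := Finset.mem_filter.mp ht
      rw [Finset.mem_union]
      by_cases hiso : t ∈ isolatedCycles T L h
      · exact Or.inl hiso
      · right
        simp only [isolatedCycles, Finset.mem_filter, not_and] at hiso
        have := hiso htT hts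
        push Not at this
        obtain ⟨t', ht', hs', hi, hne⟩ := this
        exact Finset.mem_image.mpr ⟨(t, t'), by
          simp only [near, Finset.mem_filter, Finset.mem_product]
          exact ⟨⟨⟨htT, ht'⟩, hne, hi⟩, hts, hs'⟩, rfl⟩
    exact (Finset.card_le_card hsub).trans ((Finset.card_union_le _ _).trans
      (Nat.add_le_add_left Finset.card_image_le _))
  have hsurv : ∑ L ∈ I, ∑ h ∈ ZV, ((T.filter fun t => surv L h t).card : ℝ) =
      I.card * (T.card * ZU.card) := by
    rw [← nsmul_eq_mul I.card, ← Finset.sum_const]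
    refine Finset.sum_congr rfl fun L hL => ?_
    rw [← Nat.cast_sum, ← Nat.cast_mul, Nat.cast_inj, ← smul_eq_mul, ← Finset.sum_const]
    simp only [Finset.card_filter]
    rw [Finset.sum_comm]
    refine Finset.sum_congr rfl fun t ht => ?_
    rw [← Finset.card_filter]
    exact card_translations_eq (mem_injLinearMaps.mp hL) (mem_cycles.mp ht).2
  have hnear : (near.card : ℝ) ≤ T.card * (Fintype.card ι * Δ) := by
    have h1 : near ⊆ T.biUnion fun t => (Finset.univ : Finset ι).biUnion fun i =>
        (T.filter fun t' => t' i = t i).image fun t' => (t, t') := by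
      rintro ⟨t, t'⟩ hq
      simp only [near, Finset.mem_filter, Finset.mem_product] at hq
      obtain ⟨⟨ht, ht'⟩, -, i, hi⟩ := hq
      simp only [Finset.mem_biUnion, Finset.mem_image, Finset.mem_filter]
      exact ⟨t, ht, i, Finset.mem_univ i, t', ⟨ht', hi⟩, rfl⟩
    have h2 : near.card ≤ ∑ t ∈ T, ∑ i : ι, (T.filter fun t' => t' i = t i).card :=
      (Finset.card_le_card h1).trans (Finset.card_biUnion_le.trans (Finset.sum_le_sum fun t _ =>
        Finset.card_biUnion_le.trans (Finset.sum_le_sum fun i _ => Finset.card_image_le)))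
    calc (near.card : ℝ) ≤ ∑ t ∈ T, ∑ i : ι, ((T.filter fun t' => t' i = t i).card : ℝ) := by
          exact_mod_cast h2
      _ ≤ ∑ t ∈ T, ∑ i : ι, Δ := Finset.sum_le_sum fun t _ => Finset.sum_le_sum fun i _ => hΔ i _
      _ = _ := by simp
  have hbad : ∑ L ∈ I, ∑ h ∈ ZV, ((near.filter fun q => surv L h q.1 ∧ surv L h q.2).card : ℝ) ≤
      near.card * (I.card * Fintype.card U / Fintype.card V * ZU.card) := by
    have h1 : ∑ L ∈ I, ∑ h ∈ ZV, ((near.filter fun q => surv L h q.1 ∧ surv L h q.2).card : ℝ) =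
        ∑ q ∈ near, ∑ L ∈ I, ((ZV.filter fun h => surv L h q.1 ∧ surv L h q.2).card : ℝ) := by
      simp only [Finset.card_filter, Nat.cast_sum]
      rw [Finset.sum_comm (s := near)]
      refine Finset.sum_congr rfl fun L _ => ?_
      rw [Finset.sum_comm]
    rw [h1, ← nsmul_eq_mul, ← Finset.sum_const]
    refine Finset.sum_le_sum fun q hq => ?_
    simp only [near, Finset.mem_filter, Finset.mem_product] at hq
    obtain ⟨⟨ht, ht'⟩, hne', -⟩ := hq
    obtain ⟨j, hj⟩ := Function.ne_iff.mp hne'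
    have h2 : ∀ L ∈ I, ((ZV.filter fun h => surv L h q.1 ∧ surv L h q.2).card : ℝ) ≤
        (if q.2 j - q.1 j ∈ LinearMap.range L then 1 else 0) * ZU.card := fun L hL => by
      split_ifs with hmem
      · rw [one_mul, Nat.cast_le, ← card_translations_eq (mem_injLinearMaps.mp hL)
          (mem_cycles.mp ht).2]
        exact Finset.card_le_card (Finset.monotone_filter_right _ fun h _ hh => hh.1)
      · rw [zero_mul, Nat.cast_nonpos, Finset.card_eq_zero, Finset.filter_eq_empty_iff]
        rintro h - ⟨h1, h2⟩
        refine hmem ?_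
        have := (LinearMap.range L).sub_mem (h2 j) (h1 j)
        simpa using this
    refine (Finset.sum_le_sum h2).trans ?_
    rw [← Finset.sum_mul]
    refine mul_le_mul_of_nonneg_right ?_ (Nat.cast_nonneg _)
    rw [Finset.sum_boole, le_div_iff₀ hV]
    exact_mod_cast card_filter_mem_range_mul_le (K := K) (U := U) (sub_ne_zero.mpr hj)
  have hiso : ∑ L ∈ I, ∑ h ∈ ZV, ((isolatedCycles T L h).card : ℝ) ≤ I.card * (ZV.card * B) := by
    rw [← nsmul_eq_mul, ← Finset.sum_const]
    refine Finset.sum_le_sum fun L hL => ?_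
    rw [← nsmul_eq_mul, ← Finset.sum_const]
    exact Finset.sum_le_sum fun h hh => hB L hL h (mem_cycles.mp hh).2
  have htot : (I.card : ℝ) * (T.card * ZU.card) ≤ I.card * (ZV.card * B) +
      T.card * (Fintype.card ι * Δ) * (I.card * Fintype.card U / Fintype.card V * ZU.card) := by
    rw [← hsurv]
    calc _ ≤ ∑ L ∈ I, ∑ h ∈ ZV, (((isolatedCycles T L h).card : ℝ) +
            (near.filter fun q => surv L h q.1 ∧ surv L h q.2).card) :=
          Finset.sum_le_sum fun L _ => Finset.sum_le_sum fun h _ => by exact_mod_cast hpt L h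
      _ ≤ _ := by
          simp only [Finset.sum_add_distrib]
          exact add_le_add hiso (hbad.trans (mul_le_mul_of_nonneg_right hnear (by positivity)))
  refine le_of_mul_le_mul_left ?_ hI0
  have : (I.card : ℝ) * (T.card * ZU.card * (1 - Fintype.card ι * Δ * Fintype.card U /
      Fintype.card V)) = I.card * (T.card * ZU.card) -
      T.card * (Fintype.card ι * Δ) * (I.card * Fintype.card U / Fintype.card V * ZU.card) := by
    ring
  linarith

end

section
variable {ι V : Type} [Fintype ι] [DecidableEq ι] {p : ℕ} [hp : Fact p.Prime]
  [AddCommGroup V] [Module (ZMod p) V]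

lemma card_isolatedCycles_le (hι : Fintype.card ι = 3) {e : ℕ} (X : ι → Finset V)
    {L : (Fin e → ZMod p) →ₗ[ZMod p] V} (hL : Function.Injective L) {h : ι → V}
    (hh : ∑ i, h i = 0) :
    ((isolatedCycles (cycles X) L h).card : ℝ) ≤ 3 * ((p : ℝ) ^ e) ^ (1 - cp3 p) := by
  let f : Fin 3 ≃ ι := (Fintype.equivFinOfCardEq hι).symm
  set S := isolatedCycles (cycles X) L h with hS
  have hmem : ∀ t : S, (t : ι → V) ∈ cycles X ∧ (∀ i, (t : ι → V) i + h i ∈ LinearMap.range L) ∧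
      ∀ t' ∈ cycles X, (∀ i, t' i + h i ∈ LinearMap.range L) → (∃ i, t' i = (t : ι → V) i) →
        t' = t := fun t => by
    have := t.2
    simpa only [hS, isolatedCycles, Finset.mem_filter] using this
  choose u hu using fun t : S => (hmem t).2.1
  have key := card_sumFree_le (p := p) (I := S) (fun c t => u t (f c)) ?_
  · rwa [Fintype.card_coe] at key
  intro i j k
  rw [← hL.eq_iff, L.map_add, L.map_add, L.map_zero, hu, hu, hu]
  have hh3 : h (f 0) + h (f 1) + h (f 2) = 0 := by
    rw [← Fin.sum_univ_three fun c => h (f c), Equiv.sum_comp f h, hh]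
  have hsum : ∀ a b c : V, a + h (f 0) + (b + h (f 1)) + (c + h (f 2)) = a + b + c := by
    intro a b c
    calc _ = a + b + c + (h (f 0) + h (f 1) + h (f 2)) := by abel
      _ = _ := by rw [hh3, add_zero]
  rw [hsum]
  constructor
  · intro h0
    let s : Fin 3 → S := ![i, j, k]
    let t' : ι → V := fun a => (s (f.symm a) : ι → V) a
    have hagree : ∀ c, t' (f c) = (s c : ι → V) (f c) := fun c => by simp [t']
    have ht' : t' ∈ cycles X := by
      rw [mem_cycles]
      refine ⟨fun a => (mem_cycles.mp (hmem (s (f.symm a))).1).1 a, ?_⟩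
      rw [← Equiv.sum_comp f t', Fin.sum_univ_three]
      simp only [hagree]
      exact h0
    have heq : ∀ c, t' = s c := fun c => (hmem (s c)).2.2 t' ht'
      (fun a => (hmem (s (f.symm a))).2.1 a) ⟨f c, hagree c⟩
    exact ⟨Subtype.ext ((heq 0).symm.trans (heq 1)), Subtype.ext ((heq 1).symm.trans (heq 2))⟩
  · rintro ⟨rfl, rfl⟩
    rw [← Fin.sum_univ_three fun c => (i : ι → V) (f c), Equiv.sum_comp f]
    exact (mem_cycles.mp (hmem i).1).2

lemma card_cycles_three_le [Fintype V] (hι : Fintype.card ι = 3) {n e : ℕ}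
    (hV : Fintype.card V = p ^ n) (he : e ≤ n) (X : ι → Finset V) {Δ : ℝ}
    (hΔ : ∀ i v, (((cycles X).filter fun t => t i = v).card : ℝ) ≤ Δ) :
    ((cycles X).card : ℝ) * ((p : ℝ) ^ e) ^ 2 * (1 - 3 * Δ * (p : ℝ) ^ e / (p : ℝ) ^ n) ≤
      ((p : ℝ) ^ n) ^ 2 * (3 * ((p : ℝ) ^ e) ^ (1 - cp3 p)) := by
  have : Nonempty ι := Fintype.card_pos_iff.mp (by omega)
  have hp0 : 0 < p := hp.out.pos
  have hU : Fintype.card (Fin e → ZMod p) = p ^ e := by simp [ZMod.card]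
  have hne : (injLinearMaps (ZMod p) (Fin e → ZMod p) V).Nonempty := by
    have hrank : Module.finrank (ZMod p) V = n := by
      have h1 := Module.card_eq_pow_finrank (K := ZMod p) (V := V)
      rw [hV, ZMod.card] at h1
      exact (Nat.pow_right_injective hp.out.two_le h1).symm
    have hle : Module.finrank (ZMod p) (Fin e → ZMod p) ≤ Module.finrank (ZMod p) V := by
      rw [hrank]
      simpa using he
    obtain ⟨L, hL⟩ := finrank_le_iff_exists_linearMap.mp hle
    exact ⟨L, mem_injLinearMaps.mpr hL⟩
  have key := exists_card_isolatedCycles (K := ZMod p) (U := Fin e → ZMod p) X hΔ hne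
    (fun L hL h hh => card_isolatedCycles_le hι X (mem_injLinearMaps.mp hL) hh)
  have hcard : ∀ (W : Type) [AddCommGroup W] [Fintype W], 0 < Fintype.card W →
      ((cycles fun _ : ι => (Finset.univ : Finset W)).card : ℝ) = (Fintype.card W : ℝ) ^ 2 := by
    intro W _ _ hW
    have h1 := card_cycles_univ_mul (ι := ι) (V := W)
    rw [hι, pow_succ] at h1
    exact_mod_cast Nat.eq_of_mul_eq_mul_right hW h1
  rw [hcard V Fintype.card_pos, hcard (Fin e → ZMod p) Fintype.card_pos, hU, hV, hι] at key
  push_cast at key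
  exact key

end

section
variable {ι V : Type*} [Fintype ι] [DecidableEq ι] [AddCommGroup V]

lemma PairwiseApart.mono {ι V : Type*} {D D' : Finset (ι → V)} (h : PairwiseApart D)
    (hD : D' ⊆ D) : PairwiseApart D' := fun c hc c' hc' => h c (hD hc) c' (hD hc')

lemma PairwiseApart.injOn {ι V : Type*} {D : Finset (ι → V)} (h : PairwiseApart D) (i : ι) :
    Set.InjOn (fun t : ι → V => t i) (D : Set (ι → V)) := fun c hc c' hc' hcc => by
  by_contra hne
  exact h c hc c' hc' hne i hcc

lemma PairwiseApart.card_le {ι V : Type*} [Fintype V] [Nonempty ι] {D : Finset (ι → V)}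
    (h : PairwiseApart D) : D.card ≤ Fintype.card V := by
  obtain ⟨i⟩ := ‹Nonempty ι›
  exact Finset.card_le_card_of_injOn _ (fun _ _ => Finset.mem_univ _) (h.injOn i)

/-- A system of sets minimising the ratio of the number of cycles to a power of the number of
disjoint cycles has controlled vertex degrees. -/
lemma exists_regular [Fintype V] {X : ι → Finset V} {D : Finset (ι → V)} (hD : D ⊆ cycles X)
    (hap : PairwiseApart D) (hne : D.Nonempty) {a : ℝ} (ha : 1 ≤ a) :
    ∃ (X' : ι → Finset V) (D' : Finset (ι → V)), D' ⊆ cycles X' ∧ PairwiseApart D' ∧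
      D'.Nonempty ∧
      ((cycles X').card : ℝ) / (D'.card : ℝ) ^ a ≤ ((cycles X).card : ℝ) / (D.card : ℝ) ^ a ∧
      ∀ i v, (((cycles X').filter fun t => t i = v).card : ℝ) ≤
        a * (cycles X').card / D'.card := by
  let S : Finset ((ι → Finset V) × Finset (ι → V)) := Finset.univ.filter fun q =>
    q.2 ⊆ cycles q.1 ∧ PairwiseApart q.2 ∧ q.2.Nonempty
  obtain ⟨⟨X', D'⟩, hmem, hmin⟩ := Finset.exists_min_image S
    (fun q => ((cycles q.1).card : ℝ) / (q.2.card : ℝ) ^ a)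
    ⟨(X, D), by simp only [S, Finset.mem_filter, Finset.mem_univ, true_and]; exact ⟨hD, hap, hne⟩⟩
  simp only [S, Finset.mem_filter, Finset.mem_univ, true_and] at hmem hmin
  obtain ⟨hD', hap', hne'⟩ := hmem
  refine ⟨X', D', hD', hap', hne', hmin (X, D) ⟨hD, hap, hne⟩, fun i v => ?_⟩
  set T := cycles X' with hT
  have hm0 : (0 : ℝ) < D'.card := by exact_mod_cast hne'.card_pos
  have hT0 : (0 : ℝ) < T.card := hm0.trans_le (by exact_mod_cast Finset.card_le_card hD')
  by_cases hm1 : D'.card = 1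
  · rw [hm1, Nat.cast_one, div_one]
    have h1 : ((T.filter fun t => t i = v).card : ℝ) ≤ T.card := by
      exact_mod_cast Finset.card_filter_le _ _
    nlinarith
  have hm2 : 2 ≤ D'.card := by
    have := hne'.card_pos
    omega
  let X₂ := Function.update X' i ((X' i).erase v)
  have hcyc : cycles X₂ = T.filter fun t => ¬ t i = v := by
    ext t
    simp only [hT, mem_cycles, Finset.mem_filter, X₂]
    constructor
    · rintro ⟨h1, h2⟩
      have hi := h1 i
      rw [Function.update_self, Finset.mem_erase] at hi
      refine ⟨⟨fun j => ?_, h2⟩, hi.1⟩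
      rcases eq_or_ne j i with rfl | hj
      · exact hi.2
      · simpa [hj] using h1 j
    · rintro ⟨⟨h1, h2⟩, h3⟩
      refine ⟨fun j => ?_, h2⟩
      rcases eq_or_ne j i with rfl | hj
      · simpa using ⟨h3, h1 j⟩
      · simpa [hj] using h1 j
  let D₂ := D'.filter fun t => ¬ t i = v
  have hD₂card : D'.card - 1 ≤ D₂.card := by
    have h1 : (D'.filter fun t => t i = v).card ≤ 1 := by
      rw [Finset.card_le_one]
      intro s hs t ht
      rw [Finset.mem_filter] at hs ht
      exact hap'.injOn i hs.1 ht.1 (hs.2.trans ht.2.symm)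
    have h2 := Finset.card_filter_add_card_filter_not (s := D') (fun t => t i = v)
    change _ + D₂.card = _ at h2
    omega
  have hD₂pos : 0 < D₂.card := by omega
  have hmin' := hmin (X₂, D₂) ⟨by
      rw [hcyc]
      exact Finset.filter_subset_filter _ hD', hap'.mono (Finset.filter_subset _ _),
      Finset.card_pos.mp hD₂pos⟩
  simp only [hcyc] at hmin'
  have hsplit : ((T.filter fun t => ¬ t i = v).card : ℝ) =
      T.card - (T.filter fun t => t i = v).card := by
    rw [eq_sub_iff_add_eq, add_comm]
    exact_mod_cast Finset.card_filter_add_card_filter_not (s := T) (fun t => t i = v)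
  have hm1' : (0 : ℝ) < (D'.card : ℝ) - 1 := by
    have : (2 : ℝ) ≤ D'.card := by exact_mod_cast hm2
    linarith
  have hle : (D'.card : ℝ) - 1 ≤ D₂.card := by
    have h1 : ((D'.card - 1 : ℕ) : ℝ) ≤ D₂.card := by exact_mod_cast hD₂card
    rwa [Nat.cast_sub (by omega), Nat.cast_one] at h1
  have hstep : (T.card : ℝ) / (D'.card : ℝ) ^ a ≤
      (T.card - (T.filter fun t => t i = v).card) / ((D'.card : ℝ) - 1) ^ a := by
    refine hmin'.trans ?_
    rw [hsplit]
    refine div_le_div_of_nonneg_left ?_ (Real.rpow_pos_of_pos hm1' _)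
      (Real.rpow_le_rpow hm1'.le hle (by linarith))
    rw [← hsplit]
    positivity
  have hbern : 1 + a * (-1 / D'.card) ≤ (1 + -1 / (D'.card : ℝ)) ^ a := by
    refine one_add_mul_self_le_rpow_one_add ?_ ha
    rw [le_div_iff₀ hm0]
    linarith
  have heq : 1 + -1 / (D'.card : ℝ) = (D'.card - 1) / D'.card := by
    field_simp
    ring
  rw [heq, Real.div_rpow hm1'.le hm0.le] at hbern
  rw [le_div_iff₀ (Real.rpow_pos_of_pos hm1' _)] at hstep
  have h3 := mul_le_mul_of_nonneg_left hbern hT0.le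
  have h4 : (T.card : ℝ) * (((D'.card : ℝ) - 1) ^ a / (D'.card : ℝ) ^ a) =
      T.card / (D'.card : ℝ) ^ a * ((D'.card : ℝ) - 1) ^ a := by ring
  have h5 : (T.card : ℝ) * (1 + a * (-1 / D'.card)) = T.card - a * T.card / D'.card := by ring
  linarith

end

/-- The polynomial lower bound, with exponent `C` and constant `κ`, on the number of `k`-cycles
in terms of the number of disjoint `k`-cycles. -/
def CycleBound (p k : ℕ) (C κ : ℝ) : Prop :=
  ∀ (ι V : Type) [Fintype ι] [DecidableEq ι] [AddCommGroup V] [Module (ZMod p) V] [Fintype V]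
    (X : ι → Finset V) (D : Finset (ι → V)), Fintype.card ι = k → D ⊆ cycles X →
    PairwiseApart D → D.Nonempty →
    κ * ((D.card : ℝ) / Fintype.card V) ^ C * (Fintype.card V : ℝ) ^ (k - 1) ≤ (cycles X).card

lemma cycleBound_of_regular {p k : ℕ} {C κ : ℝ} (hC : 1 ≤ C)
    (h : ∀ (ι V : Type) [Fintype ι] [DecidableEq ι] [AddCommGroup V] [Module (ZMod p) V]
      [Fintype V] (X : ι → Finset V) (D : Finset (ι → V)), Fintype.card ι = k →
      D ⊆ cycles X → PairwiseApart D → D.Nonempty →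
      (∀ i v, (((cycles X).filter fun t => t i = v).card : ℝ) ≤
        C * (cycles X).card / D.card) →
      κ * ((D.card : ℝ) / Fintype.card V) ^ C * (Fintype.card V : ℝ) ^ (k - 1) ≤
        (cycles X).card) :
    CycleBound p k C κ := by
  intro ι V _ _ _ _ _ X D hι hD hap hne
  obtain ⟨X', D', hD', hap', hne', hle, hreg⟩ := exists_regular hD hap hne hC
  have key := h ι V X' D' hι hD' hap' hne' hreg
  have hm : (0 : ℝ) < (D.card : ℝ) ^ C :=
    Real.rpow_pos_of_pos (by exact_mod_cast hne.card_pos) _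
  have hm' : (0 : ℝ) < (D'.card : ℝ) ^ C :=
    Real.rpow_pos_of_pos (by exact_mod_cast hne'.card_pos) _
  rw [Real.div_rpow (by positivity) (by positivity)] at key ⊢
  rw [div_le_div_iff₀ hm' hm] at hle
  refine le_of_mul_le_mul_right ?_ hm'
  calc _ = κ * ((D'.card : ℝ) ^ C / (Fintype.card V : ℝ) ^ C) *
        (Fintype.card V : ℝ) ^ (k - 1) * (D.card : ℝ) ^ C := by ring
    _ ≤ (cycles X').card * (D.card : ℝ) ^ C := mul_le_mul_of_nonneg_right key hm.le
    _ ≤ _ := hle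

/-- The bound for triangles. -/
theorem exists_cycleBound_three (p : ℕ) [hp : Fact p.Prime] :
    ∃ κ > 0, CycleBound p 3 (1 / cp3 p + 1) κ := by
  set c := cp3 p with hc
  have hc0 : 0 < c := cp3_pos hp.out.two_le
  have hp2 : (2 : ℝ) ≤ p := by exact_mod_cast hp.out.two_le
  set C := 1 / c + 1 with hCdef
  have hC : 1 ≤ C := by
    have : 0 < 1 / c := by positivity
    linarith
  set A := 6 * (6 * p * C) ^ (1 + c) with hA
  have hA0 : 0 < A := by positivity
  refine ⟨(1 / A) ^ (1 / c), by positivity, cycleBound_of_regular hC ?_⟩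
  intro ι V _ _ _ _ _ X D hι hD hap hne hreg
  have : Nonempty ι := Fintype.card_pos_iff.mp (by omega)
  have hVcard : Fintype.card V = p ^ Module.finrank (ZMod p) V := by
    rw [Module.card_eq_pow_finrank (K := ZMod p) (V := V), ZMod.card]
  have hmN : (D.card : ℝ) ≤ Fintype.card V := by exact_mod_cast hap.card_le
  set n := Module.finrank (ZMod p) V
  set N : ℝ := (Fintype.card V : ℝ) with hN
  set T : ℝ := ((cycles X).card : ℝ) with hT
  set m : ℝ := (D.card : ℝ) with hm
  have hNp : N = (p : ℝ) ^ n := by rw [hN, hVcard]; push_cast; rfl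
  have hm0 : 0 < m := by rw [hm]; exact_mod_cast hne.card_pos
  have hmT : m ≤ T := by rw [hm, hT]; exact_mod_cast Finset.card_le_card hD
  have hN0 : 0 < N := hm0.trans_le hmN
  have hT0 : 0 < T := hm0.trans_le hmT
  set s := T / (m * N) with hs
  have hs0 : 0 < s := by positivity
  set Δ := C * T / m with hΔ
  have hΔs : Δ = C * s * N := by
    rw [hΔ, hs]
    field_simp
  have hΔ1 : 1 ≤ Δ := by
    rw [hΔ, le_div_iff₀ hm0]
    nlinarith
  have hmain : m / N ≤ A * s ^ c := by
    rcases lt_or_ge N (6 * Δ) with hlt | hge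
    · have h1 : 1 ≤ 6 * p * C * s := by
        have h2 : 1 * N < 6 * C * s * N := by
          rw [hΔs] at hlt
          linarith
        have h3 := lt_of_mul_lt_mul_right h2 hN0.le
        nlinarith
      have h6 : 1 ≤ 6 * p * C := by nlinarith
      calc m / N ≤ 1 := (div_le_one hN0).mpr hmN
        _ ≤ (6 * p * C * s) ^ c := Real.one_le_rpow h1 hc0.le
        _ = (6 * p * C) ^ c * s ^ c := Real.mul_rpow (by positivity) hs0.le
        _ ≤ A * s ^ c := by
          refine mul_le_mul_of_nonneg_right ?_ (by positivity)
          have h7 : (6 * p * C) ^ c ≤ (6 * p * C) ^ (1 + c) :=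
            Real.rpow_le_rpow_of_exponent_le h6 (by linarith)
          have h8 : 0 < (6 * p * C) ^ (1 + c) := by positivity
          rw [hA]
          linarith
    · obtain ⟨e, he1, he2⟩ := exists_nat_pow_near (x := N / (6 * Δ)) (y := (p : ℝ))
        ((one_le_div (by positivity)).mpr hge) (by linarith)
      have hen : e ≤ n := by
        have h1 : (p : ℝ) ^ e ≤ (p : ℝ) ^ n := by
          rw [← hNp]
          exact he1.trans (div_le_self hN0.le (by linarith))
        exact (pow_le_pow_iff_right₀ (by linarith)).mp h1
      have key := card_cycles_three_le hι hVcard hen X hreg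
      rw [← hNp] at key
      set q := (p : ℝ) ^ e with hq
      have hq0 : 0 < q := by positivity
      have hhalf : (1 : ℝ) / 2 ≤ 1 - 3 * Δ * q / N := by
        have : 3 * Δ * q / N ≤ 1 / 2 := by
          rw [div_le_iff₀ hN0]
          rw [le_div_iff₀ (by positivity)] at he1
          linarith
        linarith
      have h1 : T * q ^ 2 * (1 / 2) ≤ N ^ 2 * (3 * q ^ (1 - c)) :=
        (mul_le_mul_of_nonneg_left hhalf (by positivity)).trans key
      have h2 : q ^ (1 - c) * q ^ (1 + c) = q ^ 2 := by
        rw [← Real.rpow_add hq0, ← Real.rpow_natCast]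
        congr 1
        push_cast
        ring
      have h3 : T * q ^ (1 + c) ≤ 6 * N ^ 2 := by
        have h5 : 0 < q ^ (1 - c) := by positivity
        refine le_of_mul_le_mul_right ?_ h5
        rw [mul_assoc, mul_comm (q ^ (1 + c)), h2]
        linarith
      have h4 : 1 ≤ 6 * p * C * s * q := by
        rw [pow_succ, ← hq, div_lt_iff₀ (by positivity), hΔs] at he2
        refine le_of_mul_le_mul_right ?_ hN0
        linarith
      have h5 : 1 ≤ (6 * p * C) ^ (1 + c) * s ^ (1 + c) * q ^ (1 + c) := by
        rw [← Real.mul_rpow (by positivity) hs0.le, ← Real.mul_rpow (by positivity) hq0.le]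
        exact Real.one_le_rpow h4 (by linarith)
      have h6 : T ≤ A * s ^ (1 + c) * N ^ 2 := by
        calc T = T * 1 := (mul_one T).symm
          _ ≤ T * ((6 * p * C) ^ (1 + c) * s ^ (1 + c) * q ^ (1 + c)) :=
            mul_le_mul_of_nonneg_left h5 hT0.le
          _ = (6 * p * C) ^ (1 + c) * s ^ (1 + c) * (T * q ^ (1 + c)) := by ring
          _ ≤ (6 * p * C) ^ (1 + c) * s ^ (1 + c) * (6 * N ^ 2) :=
            mul_le_mul_of_nonneg_left h3 (by positivity)
          _ = _ := by rw [hA]; ring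
      have h7 : T = s * (m * N) := by
        rw [hs]
        field_simp
      have h8 : s ^ (1 + c) = s * s ^ c := by rw [Real.rpow_add hs0, Real.rpow_one]
      rw [h8] at h6
      rw [div_le_iff₀ hN0]
      refine le_of_mul_le_mul_left ?_ (mul_pos hs0 hN0)
      nlinarith
  have hroot : (1 / A) ^ (1 / c) * (m / N) ^ (1 / c) ≤ s := by
    rw [← Real.mul_rpow (by positivity) (by positivity)]
    calc _ ≤ (s ^ c) ^ (1 / c) := by
          refine Real.rpow_le_rpow (by positivity) ?_ (by positivity)
          rw [one_div, inv_mul_le_iff₀ hA0]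
          exact hmain
      _ = s := by rw [← Real.rpow_mul hs0.le, mul_one_div_cancel hc0.ne', Real.rpow_one]
  have hexp : (m / N) ^ C = (m / N) ^ (1 / c) * (m / N) := by
    rw [hCdef, Real.rpow_add (by positivity), Real.rpow_one]
  rw [hexp]
  calc _ = (1 / A) ^ (1 / c) * (m / N) ^ (1 / c) * (m * N) := by
        field_simp
    _ ≤ s * (m * N) := mul_le_mul_of_nonneg_right hroot (by positivity)
    _ = T := by
        rw [hs]
        field_simp

section
variable {ι V : Type*} [Fintype ι] [DecidableEq ι] [AddCommGroup V]

lemma sum_update_update {x : ι → V} {a b : ι} (hab : a ≠ b) {u v : V}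
    (h : u + v = x a + x b) :
    ∑ i, Function.update (Function.update x a u) b v i = ∑ i, x i := by
  have hx : Function.update (Function.update x a u) b v =
      x + Pi.single a (u - x a) + Pi.single b (v - x b) := by
    ext i
    rcases eq_or_ne i b with rfl | hb
    · simp [Pi.single_eq_of_ne hab.symm]
    · rcases eq_or_ne i a with rfl | ha
      · simp [hb]
      · simp [ha, hb]
  simp only [hx, Pi.add_apply, Finset.sum_add_distrib, Fintype.sum_pi_single']
  rw [add_assoc, sub_add_sub_comm, h, sub_self, add_zero]

lemma update_update_mem_cycles {X : ι → Finset V} {x : ι → V} (hx : x ∈ cycles X) {a b : ι}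
    (hab : a ≠ b) {u v : V} (hu : u ∈ X a) (hv : v ∈ X b) (h : u + v = x a + x b) :
    Function.update (Function.update x a u) b v ∈ cycles X := by
  rw [mem_cycles] at hx ⊢
  refine ⟨fun i => ?_, (sum_update_update hab h).trans hx.2⟩
  rcases eq_or_ne i b with rfl | hb
  · simpa using hv
  · rcases eq_or_ne i a with rfl | ha
    · simpa [hb] using hu
    · simpa [ha, hb] using hx.1 i

/-- The representations of `s` as a sum of an element of `X a` and an element of `X b`. -/
noncomputable def sumReps {ι V : Type*} [AddCommGroup V] (X : ι → Finset V) (a b : ι) (s : V) :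
    Finset (V × V) :=
  (X a ×ˢ X b).filter fun q => q.1 + q.2 = s

lemma mem_sumReps {ι V : Type*} [AddCommGroup V] {X : ι → Finset V} {a b : ι} {s : V} {q : V × V} :
    q ∈ sumReps X a b s ↔ (q.1 ∈ X a ∧ q.2 ∈ X b) ∧ q.1 + q.2 = s := by
  simp [sumReps]

lemma card_sumReps_comm {ι V : Type*} [AddCommGroup V] (X : ι → Finset V) (a b : ι) (s : V) :
    (sumReps X a b s).card = (sumReps X b a s).card := by
  refine Finset.card_bij' (fun q _ => q.swap) (fun q _ => q.swap) ?_ ?_ ?_ ?_ <;>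
    simp +contextual [mem_sumReps, add_comm]

/-- The cycles agreeing with `t` at the coordinates `a` and `b`. -/
noncomputable def pairFiber (X : ι → Finset V) (a b : ι) (t : ι → V) : Finset (ι → V) :=
  (cycles X).filter fun x => x a = t a ∧ x b = t b

/-- The cycles with the same sum as `t` over the coordinates `a` and `b`. -/
noncomputable def sumFiber (X : ι → Finset V) (a b : ι) (t : ι → V) : Finset (ι → V) :=
  (cycles X).filter fun x => x a + x b = t a + t b

lemma mem_pairFiber {X : ι → Finset V} {a b : ι} {t x : ι → V} :
    x ∈ pairFiber X a b t ↔ x ∈ cycles X ∧ x a = t a ∧ x b = t b := by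
  simp [pairFiber]

lemma mem_sumFiber {X : ι → Finset V} {a b : ι} {t x : ι → V} :
    x ∈ sumFiber X a b t ↔ x ∈ cycles X ∧ x a + x b = t a + t b := by
  simp [sumFiber]

lemma sumFiber_comm (X : ι → Finset V) (a b : ι) (t : ι → V) :
    sumFiber X a b t = sumFiber X b a t := by
  ext x
  simp [mem_sumFiber, add_comm]

lemma card_sumFiber_le {X : ι → Finset V} {a b : ι} (hab : a ≠ b) {t : ι → V}
    (ht : t ∈ cycles X) :
    (sumFiber X a b t).card ≤ (sumReps X a b (t a + t b)).card * (pairFiber X a b t).card := by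
  rw [← Finset.card_product]
  refine Finset.card_le_card_of_injOn (fun x => ((x a, x b),
    Function.update (Function.update x a (t a)) b (t b))) ?_ ?_
  · intro x hx
    rw [Finset.mem_coe, mem_sumFiber] at hx
    simp only [Finset.coe_product, Set.mem_prod, Finset.mem_coe, mem_sumReps, mem_pairFiber]
    rw [mem_cycles] at ht
    refine ⟨⟨⟨(mem_cycles.mp hx.1).1 a, (mem_cycles.mp hx.1).1 b⟩, hx.2⟩,
      update_update_mem_cycles hx.1 hab (ht.1 a) (ht.1 b) hx.2.symm, ?_, ?_⟩ <;> simp [hab]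
  · intro x _ y _ hxy
    simp only [Prod.mk.injEq] at hxy
    ext i
    rcases eq_or_ne i b with rfl | hb
    · exact hxy.1.2
    · rcases eq_or_ne i a with rfl | ha
      · exact hxy.1.1
      · simpa [ha, hb] using congrFun hxy.2 i

lemma sum_card_sumReps_le {X : ι → Finset V} {a b c : ι} (hab : a ≠ b) (hac : a ≠ c)
    (hbc : b ≠ c) (t : ι → V) :
    ∑ x ∈ pairFiber X a b t, (sumReps X b c (x b + x c)).card ≤
      ((cycles X).filter fun x => x a = t a).card := by
  rw [← Finset.card_sigma]
  refine Finset.card_le_card_of_injOn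
    (fun z => Function.update (Function.update z.1 b z.2.1) c z.2.2) ?_ ?_
  · rintro ⟨x, u, v⟩ hx
    simp only [Finset.coe_sigma, Set.mem_sigma_iff, Finset.mem_coe, mem_pairFiber,
      mem_sumReps] at hx
    rw [Finset.mem_coe, Finset.mem_filter]
    exact ⟨update_update_mem_cycles hx.1.1 hbc hx.2.1.1 hx.2.1.2 hx.2.2,
      by simp [hab, hac, hx.1.2.1]⟩
  · rintro ⟨x, u, v⟩ hx ⟨x', u', v'⟩ hx' h
    simp only [Finset.coe_sigma, Set.mem_sigma_iff, Finset.mem_coe, mem_pairFiber,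
      mem_sumReps] at hx hx'
    have hu : u = u' := by simpa [hbc] using congrFun h b
    have hv : v = v' := by simpa using congrFun h c
    subst hu hv
    have hxx : x = x' := by
      ext i
      rcases eq_or_ne i c with rfl | hc
      · have h1 := hx.2.2.symm.trans hx'.2.2
        rw [hx.1.2.2, hx'.1.2.2] at h1
        exact add_left_cancel h1
      · rcases eq_or_ne i b with rfl | hb
        · rw [hx.1.2.2, hx'.1.2.2]
        · simpa [hb, hc] using congrFun h i
    rw [hxx]

lemma sum_sumReps_div_le {X : ι → Finset V} {a b c : ι} (hab : a ≠ b) (hac : a ≠ c)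
    (hbc : b ≠ c) {Δ : ℝ} (hΔ0 : 0 < Δ)
    (hΔ : ∀ i v, (((cycles X).filter fun t => t i = v).card : ℝ) ≤ Δ)
    {B : Finset (ι → V)} (hB : B ⊆ cycles X)
    (hbad : ∀ t ∈ B, 2 * Δ < (sumFiber X a b t).card) :
    ∑ t ∈ B, ((sumReps X b c (t b + t c)).card : ℝ) / (sumReps X a b (t a + t b)).card ≤
      (cycles X).card / 2 := by
  have h1 : ∀ t ∈ B, ((sumReps X b c (t b + t c)).card : ℝ) /
      (sumReps X a b (t a + t b)).card ≤
      (∑ x ∈ cycles X, if x ∈ pairFiber X a b t then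
        ((sumReps X b c (t b + t c)).card : ℝ) else 0) / (2 * Δ) := by
    intro t ht
    have h2 : ((sumFiber X a b t).card : ℝ) ≤
        (sumReps X a b (t a + t b)).card * (pairFiber X a b t).card := by
      exact_mod_cast card_sumFiber_le hab (hB ht)
    have h3 := (hbad t ht).trans_le h2
    have h4 : (0 : ℝ) < (sumReps X a b (t a + t b)).card := by
      rcases Nat.eq_zero_or_pos (sumReps X a b (t a + t b)).card with h | h
      · rw [h] at h3
        norm_num at h3
        linarith
      · exact_mod_cast h
    rw [← Finset.sum_filter, Finset.sum_const, nsmul_eq_mul]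
    have h5 : (cycles X).filter (fun x => x ∈ pairFiber X a b t) = pairFiber X a b t := by
      ext x
      simp only [Finset.mem_filter, mem_pairFiber]
      tauto
    rw [h5, div_le_div_iff₀ h4 (by positivity)]
    have h6 := mul_le_mul_of_nonneg_left h3.le
      (Nat.cast_nonneg (α := ℝ) (sumReps X b c (t b + t c)).card)
    linarith
  calc _ ≤ ∑ t ∈ B, (∑ x ∈ cycles X, if x ∈ pairFiber X a b t then
        ((sumReps X b c (t b + t c)).card : ℝ) else 0) / (2 * Δ) := Finset.sum_le_sum h1
    _ ≤ ∑ t ∈ cycles X, (∑ x ∈ cycles X, if x ∈ pairFiber X a b t then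
        ((sumReps X b c (t b + t c)).card : ℝ) else 0) / (2 * Δ) :=
      Finset.sum_le_sum_of_subset_of_nonneg hB fun t _ _ =>
        div_nonneg (Finset.sum_nonneg fun x _ => by positivity) (by positivity)
    _ = (∑ x ∈ cycles X, ∑ t ∈ pairFiber X a b x,
        ((sumReps X b c (t b + t c)).card : ℝ)) / (2 * Δ) := by
      rw [← Finset.sum_div, Finset.sum_comm]
      congr 1
      refine Finset.sum_congr rfl fun x hx => ?_
      rw [← Finset.sum_filter]
      refine Finset.sum_congr ?_ fun _ _ => rfl
      ext t
      simp only [Finset.mem_filter, mem_pairFiber, hx, true_and, eq_comm]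
    _ ≤ (∑ x ∈ cycles X, Δ) / (2 * Δ) := by
      refine div_le_div_of_nonneg_right (Finset.sum_le_sum fun x _ => ?_) (by positivity)
      refine le_trans ?_ (hΔ a (x a))
      exact_mod_cast sum_card_sumReps_le hab hac hbc x
    _ = _ := by
      rw [Finset.sum_const, nsmul_eq_mul]
      field_simp

/-- One of two overlapping pairs of coordinates has few cycles per pair sum for a positive
proportion of the cycles. -/
lemma exists_goodPair {X : ι → Finset V} {a b c : ι} (hab : a ≠ b) (hac : a ≠ c)
    (hbc : b ≠ c) {Δ : ℝ} (hΔ0 : 0 < Δ)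
    (hΔ : ∀ i v, (((cycles X).filter fun t => t i = v).card : ℝ) ≤ Δ) :
    ∃ a' b', a' ≠ b' ∧ ((cycles X).card : ℝ) / 4 ≤
      ((cycles X).filter fun t => ((sumFiber X a' b' t).card : ℝ) ≤ 2 * Δ).card := by
  let G := fun a' b' : ι => (cycles X).filter fun t => ((sumFiber X a' b' t).card : ℝ) ≤ 2 * Δ
  let B := (cycles X).filter fun t =>
    2 * Δ < (sumFiber X a b t).card ∧ 2 * Δ < (sumFiber X b c t).card
  have hB : B ⊆ cycles X := Finset.filter_subset _ _
  have h1 := sum_sumReps_div_le hab hac hbc hΔ0 hΔ hB fun t ht => (Finset.mem_filter.mp ht).2.1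
  have h2 := sum_sumReps_div_le hbc.symm hac.symm hab.symm hΔ0 hΔ hB fun t ht => by
    rw [sumFiber_comm]
    exact (Finset.mem_filter.mp ht).2.2
  have h3 : (B.card : ℝ) * 2 ≤ (cycles X).card := by
    calc (B.card : ℝ) * 2 = ∑ _t ∈ B, (2 : ℝ) := by simp
      _ ≤ ∑ t ∈ B, (((sumReps X b c (t b + t c)).card : ℝ) / (sumReps X a b (t a + t b)).card
          + ((sumReps X b a (t b + t a)).card : ℝ) / (sumReps X c b (t c + t b)).card) := by
        refine Finset.sum_le_sum fun t ht => ?_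
        have ht' := mem_cycles.mp (hB ht)
        have hpos : ∀ i j, (0 : ℝ) < (sumReps X i j (t i + t j)).card := fun i j => by
          exact_mod_cast Finset.card_pos.mpr
            ⟨(t i, t j), mem_sumReps.mpr ⟨⟨ht'.1 i, ht'.1 j⟩, rfl⟩⟩
        rw [card_sumReps_comm X b a, card_sumReps_comm X c b, add_comm (t b) (t a),
          add_comm (t c) (t b)]
        have hx := hpos a b
        have hy := hpos b c
        rw [div_add_div _ _ hx.ne' hy.ne', le_div_iff₀ (by positivity)]
        nlinarith [sq_nonneg (((sumReps X b c (t b + t c)).card : ℝ) -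
          (sumReps X a b (t a + t b)).card)]
      _ ≤ _ := by
        rw [Finset.sum_add_distrib]
        linarith
  have h4 : ((cycles X).card : ℝ) ≤ (G a b).card + (G b c).card + B.card := by
    have h5 : cycles X ⊆ G a b ∪ G b c ∪ B := by
      intro t ht
      simp only [G, B, Finset.mem_union, Finset.mem_filter, ht, true_and]
      by_contra! h
      exact (h.2 h.1.1).not_gt h.1.2
    have h6 := (Finset.card_le_card h5).trans (Finset.card_union_le _ _)
    have h7 := Finset.card_union_le (G a b) (G b c)
    exact_mod_cast h6.trans (by omega)
  rcases le_total (G a b).card (G b c).card with h | h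
  · refine ⟨b, c, hbc, ?_⟩
    have : ((G a b).card : ℝ) ≤ (G b c).card := by exact_mod_cast h
    change _ ≤ ((G b c).card : ℝ)
    linarith
  · refine ⟨a, b, hab, ?_⟩
    have : ((G b c).card : ℝ) ≤ (G a b).card := by exact_mod_cast h
    change _ ≤ ((G a b).card : ℝ)
    linarith

/-- A family of tuples with bounded degrees contains a large subfamily of pairwise disjoint
tuples with distinct sums over a pair of coordinates. -/
lemma exists_apart_subfamily {ι V : Type*} [Fintype ι] [AddCommGroup V] {F : Finset (ι → V)}
    {a b : ι} {Δ Δ' : ℝ}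
    (hΔ : ∀ i v, ((F.filter fun t => t i = v).card : ℝ) ≤ Δ)
    (hΔ' : ∀ t ∈ F, ((F.filter fun x => x a + x b = t a + t b).card : ℝ) ≤ Δ') :
    ∃ M ⊆ F, PairwiseApart M ∧ Set.InjOn (fun t : ι → V => t a + t b) M ∧
      (F.card : ℝ) ≤ M.card * (Fintype.card ι * Δ + Δ') := by
  let S := F.powerset.filter fun M =>
    PairwiseApart M ∧ Set.InjOn (fun t : ι → V => t a + t b) (M : Set (ι → V))
  obtain ⟨M, hM, hmax⟩ := Finset.exists_max_image S Finset.card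
    ⟨∅, by
      simp only [S, Finset.mem_filter, Finset.mem_powerset]
      simp [PairwiseApart]⟩
  simp only [S, Finset.mem_filter, Finset.mem_powerset] at hM hmax
  refine ⟨M, hM.1, hM.2.1, hM.2.2, ?_⟩
  have hcover : F ⊆ M.biUnion fun t =>
      (Finset.univ.biUnion fun i => F.filter fun x => x i = t i) ∪
        F.filter fun x => x a + x b = t a + t b := by
    intro x hx
    by_contra hcon
    simp only [Finset.mem_biUnion, Finset.mem_union, Finset.mem_filter, Finset.mem_univ,
      true_and, hx, not_exists, not_and, not_or] at hcon
    have hxM : x ∉ M := fun h => (hcon x h).2 rfl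
    have hins : insert x M ⊆ F ∧ PairwiseApart (insert x M) ∧
        Set.InjOn (fun t : ι → V => t a + t b) (insert x M : Finset (ι → V)) := by
      refine ⟨Finset.insert_subset hx hM.1, ?_, ?_⟩
      · intro s hs t ht hst i
        rw [Finset.mem_insert] at hs ht
        rcases hs with rfl | hs <;> rcases ht with rfl | ht
        · exact absurd rfl hst
        · exact (hcon t ht).1 i
        · exact fun h => (hcon s hs).1 i h.symm
        · exact hM.2.1 s hs t ht hst i
      · intro s hs t ht hst
        rw [Finset.mem_coe, Finset.mem_insert] at hs ht
        rcases hs with rfl | hs <;> rcases ht with rfl | ht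
        · rfl
        · exact absurd hst (hcon t ht).2
        · exact absurd hst.symm (hcon s hs).2
        · exact hM.2.2 hs ht hst
    have h1 := hmax _ hins
    rw [Finset.card_insert_of_notMem hxM] at h1
    omega
  have h1 := (Finset.card_le_card hcover).trans Finset.card_biUnion_le
  calc (F.card : ℝ) ≤ ∑ t ∈ M, (((Finset.univ.biUnion fun i => F.filter fun x => x i = t i) ∪
        F.filter fun x => x a + x b = t a + t b).card : ℝ) := by exact_mod_cast h1
    _ ≤ ∑ t ∈ M, (Fintype.card ι * Δ + Δ') := by
      refine Finset.sum_le_sum fun t ht => ?_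
      have h2 : (((Finset.univ.biUnion fun i => F.filter fun x => x i = t i) ∪
        F.filter fun x => x a + x b = t a + t b).card : ℝ) ≤
        ((Finset.univ.biUnion fun i => F.filter fun x => x i = t i).card : ℝ) +
        (F.filter fun x => x a + x b = t a + t b).card := by
        exact_mod_cast Finset.card_union_le _ _
      have h3 : ((Finset.univ.biUnion fun i => F.filter fun x => x i = t i).card : ℝ) ≤
          ∑ i : ι, ((F.filter fun x => x i = t i).card : ℝ) := by
        exact_mod_cast Finset.card_biUnion_le
      have h4 : ∑ i : ι, ((F.filter fun x => x i = t i).card : ℝ) ≤ ∑ _i : ι, Δ :=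
        Finset.sum_le_sum fun i _ => hΔ i (t i)
      rw [Finset.sum_const, nsmul_eq_mul, Finset.card_univ] at h4
      linarith [hΔ' t (hM.1 ht)]
    _ = _ := by rw [Finset.sum_const, nsmul_eq_mul]

end

section
variable {ι V : Type} [Fintype ι] [DecidableEq ι] [AddCommGroup V] [Fintype V]

lemma card_le_of_sumReps_lt {p : ℕ} [Module (ZMod p) V] {r κ θ : ℝ}
    (h3 : CycleBound p 3 (r + 1) κ) {X : ι → Finset V} {a b : ι} {M : Finset (ι → V)}
    (hM : M ⊆ cycles X) (hap : PairwiseApart M) (hne : M.Nonempty)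
    (hinj : Set.InjOn (fun t : ι → V => t a + t b) M)
    (hθ : ∀ t ∈ M, ((sumReps X a b (t a + t b)).card : ℝ) < θ) :
    κ * ((M.card : ℝ) / Fintype.card V) ^ r * Fintype.card V < θ := by
  let s : (ι → V) → V := fun t => t a + t b
  let X₃ : Fin 3 → Finset V := ![X a, X b, M.image fun t => -s t]
  let g : (ι → V) → Fin 3 → V := fun t => ![t a, t b, -s t]
  have hginj : Set.InjOn g M := fun x hx y hy hxy => hap.injOn a hx hy (congrFun hxy 0)
  have hD : M.image g ⊆ cycles X₃ := by
    intro y hy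
    obtain ⟨t, ht, rfl⟩ := Finset.mem_image.mp hy
    have ht' := mem_cycles.mp (hM ht)
    rw [mem_cycles]
    refine ⟨fun i => ?_, by simp [g, s, Fin.sum_univ_three]⟩
    fin_cases i
    · exact ht'.1 a
    · exact ht'.1 b
    · exact Finset.mem_image_of_mem _ ht
  have hapD : PairwiseApart (M.image g) := by
    intro y hy y' hy' hne i
    obtain ⟨t, ht, rfl⟩ := Finset.mem_image.mp hy
    obtain ⟨t', ht', rfl⟩ := Finset.mem_image.mp hy'
    have htt : t ≠ t' := fun h => hne (by rw [h])
    fin_cases i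
    · exact hap t ht t' ht' htt a
    · exact hap t ht t' ht' htt b
    · exact fun h => htt (hinj ht ht' (neg_injective h))
  have key := h3 (Fin 3) V X₃ (M.image g) (Fintype.card_fin 3) hD hapD (hne.image g)
  rw [Finset.card_image_of_injOn hginj] at key
  have hcard : ((cycles X₃).card : ℝ) < M.card * θ := by
    have hsub : cycles X₃ ⊆ M.biUnion fun t =>
        (sumReps X a b (s t)).image fun q => ![q.1, q.2, -s t] := by
      intro x hx
      rw [mem_cycles, Fin.sum_univ_three] at hx
      obtain ⟨t, ht, hts⟩ := Finset.mem_image.mp (hx.1 2)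
      rw [Finset.mem_biUnion]
      refine ⟨t, ht, Finset.mem_image.mpr ⟨(x 0, x 1),
        mem_sumReps.mpr ⟨⟨hx.1 0, hx.1 1⟩, ?_⟩, ?_⟩⟩
      · have h := hx.2
        rw [← hts] at h
        exact add_neg_eq_zero.mp h
      · ext i
        fin_cases i
        · rfl
        · rfl
        · exact hts
    have h1 : ((cycles X₃).card : ℝ) ≤ ∑ t ∈ M, ((sumReps X a b (s t)).card : ℝ) := by
      exact_mod_cast ((Finset.card_le_card hsub).trans Finset.card_biUnion_le).trans
        (Finset.sum_le_sum fun t _ => Finset.card_image_le)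
    refine h1.trans_lt ?_
    rw [← nsmul_eq_mul, ← Finset.sum_const]
    exact Finset.sum_lt_sum_of_nonempty hne hθ
  have hm0 : (0 : ℝ) < M.card := by exact_mod_cast hne.card_pos
  have : Nonempty ι := ⟨a⟩
  have hN0 : (0 : ℝ) < Fintype.card V := hm0.trans_le (by exact_mod_cast hap.card_le)
  rw [Real.rpow_add (by positivity), Real.rpow_one] at key
  refine lt_of_mul_lt_mul_left ?_ hm0.le
  refine lt_of_le_of_lt (le_of_eq ?_) (key.trans_lt hcard)
  norm_num
  field_simp

lemma card_cycles_ge_of_le_sumReps {p k : ℕ} [Module (ZMod p) V] {C κ θ : ℝ}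
    (hk : CycleBound p k C κ) (hι : Fintype.card ι = k + 1)
    {X : ι → Finset V} {a b : ι} (hab : a ≠ b) {M : Finset (ι → V)}
    (hM : M ⊆ cycles X) (hap : PairwiseApart M) (hne : M.Nonempty)
    (hinj : Set.InjOn (fun t : ι → V => t a + t b) M)
    (hθ0 : 0 ≤ θ) (hθ : ∀ t ∈ M, θ ≤ (sumReps X a b (t a + t b)).card) :
    κ * ((M.card : ℝ) / Fintype.card V) ^ C * (Fintype.card V : ℝ) ^ (k - 1) * θ ≤
      (cycles X).card := by
  let s : (ι → V) → V := fun t => t a + t b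
  let a' : {i // i ≠ b} := ⟨a, hab⟩
  let X' : {i // i ≠ b} → Finset V := fun i => if i = a' then M.image s else X i
  let g : (ι → V) → {i // i ≠ b} → V := fun t i => t i + if i = a' then t b else 0
  have hga : ∀ t, g t a' = s t := fun t => by simp [g, s, a']
  have hgi : ∀ t i, i ≠ a' → g t i = t i := fun t i hi => by simp [g, hi]
  have hgsum : ∀ t, ∑ i, g t i = ∑ i, t i := by
    intro t
    simp only [g, Finset.sum_add_distrib, Finset.sum_ite_eq', Finset.mem_univ, if_true]
    rw [Fintype.sum_eq_add_sum_subtype_ne t b, add_comm]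
  have hginj : Set.InjOn g M := fun x hx y hy hxy => hinj hx hy (by
    have := congrFun hxy a'
    rwa [hga, hga] at this)
  have hD : M.image g ⊆ cycles X' := by
    intro y hy
    obtain ⟨t, ht, rfl⟩ := Finset.mem_image.mp hy
    have ht' := mem_cycles.mp (hM ht)
    rw [mem_cycles, hgsum]
    refine ⟨fun i => ?_, ht'.2⟩
    by_cases hi : i = a'
    · subst hi
      rw [hga]
      simpa [X'] using Finset.mem_image_of_mem s ht
    · rw [hgi t i hi]
      simpa [X', hi] using ht'.1 i
  have hapD : PairwiseApart (M.image g) := by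
    intro y hy y' hy' hne i
    obtain ⟨t, ht, rfl⟩ := Finset.mem_image.mp hy
    obtain ⟨t', ht', rfl⟩ := Finset.mem_image.mp hy'
    have htt : t ≠ t' := fun h => hne (by rw [h])
    by_cases hi : i = a'
    · subst hi
      rw [hga, hga]
      exact fun h => htt (hinj ht ht' h)
    · rw [hgi t i hi, hgi t' i hi]
      exact hap t ht t' ht' htt i
  have hcard : Fintype.card {i // i ≠ b} = k := by
    rw [Fintype.card_subtype_compl, hι]
    simp
  have key := hk {i // i ≠ b} V X' (M.image g) hcard hD hapD (hne.image g)
  rw [Finset.card_image_of_injOn hginj] at key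
  refine (mul_le_mul_of_nonneg_right key hθ0).trans ?_
  have hfib : ∀ y ∈ cycles X', θ ≤ (((cycles X).filter fun x => g x = y).card : ℝ) := by
    intro y hy
    rw [mem_cycles] at hy
    have hya := hy.1 a'
    simp only [X', if_true] at hya
    obtain ⟨t, ht, hts⟩ := Finset.mem_image.mp hya
    refine (hθ t ht).trans ?_
    have h1 : (sumReps X a b (t a + t b)).card ≤
        ((cycles X).filter fun x => g x = y).card := by
      let f : V × V → ι → V := fun q i =>
        if h : i = b then q.2 else if i = a then q.1 else y ⟨i, h⟩
      have hfa : ∀ q, f q a = q.1 := fun q => by simp [f, hab]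
      have hfb : ∀ q, f q b = q.2 := fun q => by simp [f]
      have hfi : ∀ q (i : {i // i ≠ b}), i ≠ a' → f q i = y i := fun q i hi => by
        have hi' : (i : ι) ≠ a := fun h => hi (Subtype.ext h)
        simp [f, i.2, hi']
      refine Finset.card_le_card_of_injOn f (fun q hq => ?_) fun q _ q' _ hqq => ?_
      · rw [Finset.mem_coe, mem_sumReps] at hq
        have hg : g (f q) = y := by
          ext i
          by_cases hi : i = a'
          · rw [hi, hga, ← hts]
            change f q a + f q b = t a + t b
            rw [hfa, hfb, hq.2]
          · rw [hgi _ i hi, hfi q i hi]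
        rw [Finset.mem_coe, Finset.mem_filter, mem_cycles, ← hgsum, hg]
        refine ⟨⟨fun i => ?_, hy.2⟩, rfl⟩
        by_cases hb : i = b
        · rw [hb, hfb]
          exact hq.1.2
        · by_cases ha : i = a
          · rw [ha, hfa]
            exact hq.1.1
          · have hne : (⟨i, hb⟩ : {i // i ≠ b}) ≠ a' := fun h => ha (congrArg Subtype.val h)
            have h1 := hy.1 ⟨i, hb⟩
            rw [← hfi q _ hne] at h1
            simpa [X', hne] using h1
      · have h1 := congrFun hqq a
        have h2 := congrFun hqq b
        rw [hfa, hfa] at h1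
        rw [hfb, hfb] at h2
        exact Prod.ext h1 h2
    exact_mod_cast h1
  have h2 : ∑ y ∈ cycles X', ((cycles X).filter fun x => g x = y).card ≤ (cycles X).card := by
    rw [Finset.sum_card_fiberwise_eq_card_filter]
    exact Finset.card_filter_le _ _
  calc ((cycles X').card : ℝ) * θ = ∑ _y ∈ cycles X', θ := by
        rw [Finset.sum_const, nsmul_eq_mul]
    _ ≤ ∑ y ∈ cycles X', (((cycles X).filter fun x => g x = y).card : ℝ) :=
      Finset.sum_le_sum hfib
    _ ≤ _ := by exact_mod_cast h2

lemma card_cycles_ge_of_injOn_sum {p k : ℕ} [Module (ZMod p) V] {r C κ₃ κ : ℝ} (hr : 0 ≤ r)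
    (hC : 0 ≤ C) (hκ₃ : 0 ≤ κ₃) (hκ : 0 ≤ κ) (h3 : CycleBound p 3 (r + 1) κ₃)
    (hk : CycleBound p k C κ) (hk1 : 1 ≤ k) (hι : Fintype.card ι = k + 1)
    {X : ι → Finset V} {a b : ι} (hab : a ≠ b) {M : Finset (ι → V)}
    (hM : M ⊆ cycles X) (hap : PairwiseApart M) (hne : M.Nonempty)
    (hinj : Set.InjOn (fun t : ι → V => t a + t b) M) :
    κ₃ * κ * ((M.card : ℝ) / (2 * Fintype.card V)) ^ (r + C) * (Fintype.card V : ℝ) ^ k ≤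
      (cycles X).card := by
  have : Nonempty ι := ⟨a⟩
  have hm0 : (0 : ℝ) < M.card := by exact_mod_cast hne.card_pos
  have hN0 : (0 : ℝ) < Fintype.card V := hm0.trans_le (by exact_mod_cast hap.card_le)
  set N : ℝ := (Fintype.card V : ℝ) with hN
  set m : ℝ := (M.card : ℝ) with hm
  set θ := κ₃ * (m / (2 * N)) ^ r * N with hθ
  let P : (ι → V) → Prop := fun t => ((sumReps X a b (t a + t b)).card : ℝ) < θ
  have hsplit : ((M.filter P).card : ℝ) + (M.filter fun t => ¬ P t).card = m := by
    rw [hm]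
    exact_mod_cast Finset.card_filter_add_card_filter_not (s := M) P
  have hhalf : ∀ M' : Finset (ι → V), m / 2 ≤ (M'.card : ℝ) →
      M'.Nonempty ∧ m / (2 * N) ≤ M'.card / N := by
    intro M' h
    refine ⟨Finset.card_pos.mp (by exact_mod_cast (half_pos hm0).trans_le h), ?_⟩
    rw [← div_div]
    exact div_le_div_of_nonneg_right h hN0.le
  rcases le_or_gt (m / 2) ((M.filter P).card : ℝ) with h | h
  · exfalso
    obtain ⟨hne', hle⟩ := hhalf _ h
    have h1 := card_le_of_sumReps_lt h3 ((Finset.filter_subset P M).trans hM)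
      (hap.mono (Finset.filter_subset P M)) hne'
      (hinj.mono (by exact_mod_cast Finset.filter_subset P M))
      fun t ht => (Finset.mem_filter.mp ht).2
    refine absurd h1 (not_lt.mpr ?_)
    refine hθ.le.trans ?_
    gcongr
  · obtain ⟨hne', hle⟩ := hhalf (M.filter fun t => ¬ P t) (by linarith)
    have h1 := card_cycles_ge_of_le_sumReps (θ := θ) hk hι hab
      ((Finset.filter_subset _ M).trans hM)
      (hap.mono (Finset.filter_subset _ M)) hne'
      (hinj.mono (by exact_mod_cast Finset.filter_subset _ M)) (by positivity)
      fun t ht => not_lt.mp (Finset.mem_filter.mp ht).2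
    refine le_trans ?_ h1
    obtain ⟨j, rfl⟩ : ∃ j, k = j + 1 := ⟨k - 1, by omega⟩
    calc κ₃ * κ * (m / (2 * N)) ^ (r + C) * N ^ (j + 1)
        = κ * (m / (2 * N)) ^ C * N ^ (j + 1 - 1) * θ := by
          rw [hθ, Real.rpow_add (by positivity), Nat.add_sub_cancel]
          ring
      _ ≤ _ := by gcongr

end

lemma exists_cycleBound_succ {p k : ℕ} {r C κ₃ κ : ℝ} (hr : 0 ≤ r) (hC : 1 ≤ C)
    (hκ₃ : 0 < κ₃) (hκ : 0 < κ) (h3 : CycleBound p 3 (r + 1) κ₃)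
    (hk : CycleBound p k C κ) (hk2 : 2 ≤ k) :
    ∃ κ' > 0, CycleBound p (k + 1) (r + C) κ' := by
  set E := r + C with hE
  have hE1 : 1 ≤ E := by linarith
  set A : ℝ := 8 * ((k + 3) * E) with hA
  have hA0 : 0 < A := by positivity
  refine ⟨κ₃ * κ * (1 / A) ^ E, by positivity, cycleBound_of_regular hE1 ?_⟩
  intro ι V _ _ _ _ _ X D hι hD hap hne hreg
  obtain ⟨a, b, c, hab, hac, hbc⟩ := Fintype.two_lt_card_iff.mp (by omega : 2 < Fintype.card ι)
  have : Nonempty ι := ⟨a⟩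
  have hmN : (D.card : ℝ) ≤ Fintype.card V := by exact_mod_cast hap.card_le
  set N : ℝ := (Fintype.card V : ℝ) with hN
  set T : ℝ := ((cycles X).card : ℝ) with hT
  set m : ℝ := (D.card : ℝ) with hm
  have hm0 : 0 < m := by rw [hm]; exact_mod_cast hne.card_pos
  have hmT : m ≤ T := by rw [hm, hT]; exact_mod_cast Finset.card_le_card hD
  have hN0 : 0 < N := hm0.trans_le hmN
  have hT0 : 0 < T := hm0.trans_le hmT
  set Δ := E * T / m with hΔ
  have hΔ0 : 0 < Δ := by positivity
  obtain ⟨a', b', hab', hgood⟩ := exists_goodPair hab hac hbc hΔ0 hreg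
  set F := (cycles X).filter fun t => ((sumFiber X a' b' t).card : ℝ) ≤ 2 * Δ with hF
  obtain ⟨M, hMF, hMap, hMinj, hMcard⟩ := exists_apart_subfamily (F := F) (a := a') (b := b')
    (Δ := Δ) (Δ' := 2 * Δ) (fun i v => le_trans (by
      exact_mod_cast Finset.card_le_card
        (Finset.filter_subset_filter _ (Finset.filter_subset _ _))) (hreg i v))
    (fun t ht => le_trans (by
      exact_mod_cast Finset.card_le_card
        (Finset.filter_subset_filter _ (Finset.filter_subset _ _)))
      (Finset.mem_filter.mp ht).2)
  have hMm : 2 * m / A ≤ M.card := by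
    have h1 : T / 4 ≤ M.card * ((k + 3) * (E * T / m)) := by
      refine hgood.trans (hMcard.trans (le_of_eq ?_))
      rw [hι, hΔ]
      push_cast
      ring
    have h2 : T / 4 * m ≤ M.card * ((k + 3) * E) * T := by
      have h3 := mul_le_mul_of_nonneg_right h1 hm0.le
      refine h3.trans (le_of_eq ?_)
      field_simp
    rw [div_le_iff₀ hA0, hA]
    nlinarith
  have hM0 : M.Nonempty := Finset.card_pos.mp (by
    have : 0 < 2 * m / A := by positivity
    exact_mod_cast this.trans_le hMm)
  have key := card_cycles_ge_of_injOn_sum hr (by linarith) hκ₃.le hκ.le h3 hk (by omega) hι hab'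
    (hMF.trans (Finset.filter_subset _ _)) hMap hM0 hMinj
  refine le_trans ?_ key
  have h1 : 1 / A * (m / N) ≤ M.card / (2 * N) := by
    rw [div_mul_div_comm, one_mul, div_le_div_iff₀ (by positivity) (by positivity)]
    rw [div_le_iff₀ hA0] at hMm
    nlinarith
  calc _ = κ₃ * κ * (1 / A * (m / N)) ^ E * N ^ k := by
        rw [Real.mul_rpow (by positivity) (by positivity), Nat.add_sub_cancel]
        ring
    _ ≤ _ := by gcongr

theorem exists_cycleBound (p : ℕ) [hp : Fact p.Prime] {k : ℕ} (hk : 3 ≤ k) :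
    ∃ κ > 0, CycleBound p k (Cconst p k) κ := by
  have hc : 0 < 1 / cp3 p := one_div_pos.mpr (cp3_pos hp.out.two_le)
  obtain ⟨κ₃, hκ₃, h3⟩ := exists_cycleBound_three p
  induction k, hk using Nat.le_induction with
  | base =>
    refine ⟨κ₃, hκ₃, ?_⟩
    have : Cconst p 3 = 1 / cp3 p + 1 := by
      rw [Cconst]
      norm_num
    rwa [this]
  | succ k hk ih =>
    obtain ⟨κ, hκ, h⟩ := ih
    have hk' : (3 : ℝ) ≤ k := by exact_mod_cast hk
    have hC : 1 ≤ Cconst p k := by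
      rw [Cconst, div_eq_mul_one_div]
      nlinarith
    obtain ⟨κ', hκ', h'⟩ := exists_cycleBound_succ hc.le hC hκ₃ hκ h3 h (by omega)
    refine ⟨κ', hκ', ?_⟩
    have : Cconst p (k + 1) = 1 / cp3 p + Cconst p k := by
      rw [Cconst, Cconst]
      push_cast
      ring
    rwa [this]

section
variable {ι V : Type} [Fintype ι] [DecidableEq ι] [AddCommGroup V]

/-- The families of `r` tuples from `D`, viewed as tuples of vectors of length `r`. -/
noncomputable def tensorPower {ι V : Type} (D : Finset (ι → V)) (r : ℕ) : Finset (ι → Fin r → V) :=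
  (Fintype.piFinset fun _ : Fin r => D).image fun s i j => s j i

lemma mem_tensorPower {ι V : Type} {D : Finset (ι → V)} {r : ℕ} {x : ι → Fin r → V} :
    x ∈ tensorPower D r ↔ ∀ j, (fun i => x i j) ∈ D := by
  simp only [tensorPower, Finset.mem_image, Fintype.mem_piFinset]
  constructor
  · rintro ⟨s, hs, rfl⟩ j
    exact hs j
  · exact fun h => ⟨fun j i => x i j, h, rfl⟩

lemma card_tensorPower {ι V : Type} (D : Finset (ι → V)) (r : ℕ) :
    (tensorPower D r).card = D.card ^ r := by
  rw [tensorPower, Finset.card_image_of_injective]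
  · simp
  · exact fun s t h => funext fun j => funext fun i => congrFun (congrFun h i) j

lemma cycles_tensorPower (X : ι → Finset V) (r : ℕ) :
    cycles (fun i => Fintype.piFinset fun _ : Fin r => X i) = tensorPower (cycles X) r := by
  ext x
  simp only [mem_tensorPower, mem_cycles, Fintype.mem_piFinset, funext_iff, Finset.sum_apply,
    Pi.zero_apply]
  exact ⟨fun h j => ⟨fun i => h.1 i j, h.2 j⟩, fun h => ⟨fun i j => (h j).1 i, fun j => (h j).2⟩⟩

lemma PairwiseApart.tensorPower {ι V : Type} {D : Finset (ι → V)} (h : PairwiseApart D) (r : ℕ) :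
    PairwiseApart (tensorPower D r) := by
  intro x hx y hy hxy i hi
  rw [mem_tensorPower] at hx hy
  refine hxy (funext fun l => funext fun j => ?_)
  exact congrFun (h.injOn i (hx j) (hy j) (congrFun hi j)) l

/-- The constant in a polynomial bound can be removed by passing to powers. -/
lemma CycleBound.one {p k : ℕ} {C κ : ℝ} (hκ : 0 < κ) (h : CycleBound p k C κ) :
    CycleBound p k C 1 := by
  intro ι V _ _ _ _ _ X D hι hD hap hne
  set b := 1 * ((D.card : ℝ) / Fintype.card V) ^ C * (Fintype.card V : ℝ) ^ (k - 1) with hb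
  have hT0 : (0 : ℝ) < (cycles X).card := by
    exact_mod_cast hne.card_pos.trans_le (Finset.card_le_card hD)
  have key : ∀ r : ℕ, κ * b ^ r ≤ ((cycles X).card : ℝ) ^ r := by
    intro r
    have h1 := h ι (Fin r → V) (fun i => Fintype.piFinset fun _ => X i) (tensorPower D r) hι
      (by
        rw [cycles_tensorPower]
        intro x hx
        rw [mem_tensorPower] at hx ⊢
        exact fun j => hD (hx j))
      (hap.tensorPower r)
      (Finset.card_pos.mp (by rw [card_tensorPower]; exact pow_pos hne.card_pos r))
    rw [cycles_tensorPower, card_tensorPower, card_tensorPower, Fintype.card_fun,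
      Fintype.card_fin] at h1
    push_cast at h1
    refine le_trans (le_of_eq ?_) h1
    rw [hb, one_mul, mul_pow, ← div_pow, ← Real.rpow_natCast, ← Real.rpow_mul (by positivity),
      ← Real.rpow_natCast (_ / _), ← Real.rpow_mul (by positivity), mul_comm C, pow_right_comm,
      mul_assoc]
  by_contra! hlt
  have hratio : 1 < b / (cycles X).card := (one_lt_div hT0).mpr hlt
  obtain ⟨r, hr⟩ := pow_unbounded_of_one_lt (1 / κ) hratio
  rw [div_pow, div_lt_div_iff₀ hκ (pow_pos hT0 r)] at hr
  linarith [key r]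

end

theorem disjoint_cycles_bound (p : ℕ) [hp : Fact p.Prime] (k : ℕ) (hk : 3 ≤ k)
    (ε δ : ℝ) (hε0 : 0 < ε) (hε1 : ε < 1) (hδ : δ = ε ^ Cconst p k)
    (n : ℕ) (hn : 0 < n) (X : Fin k → Finset (Fin n → ZMod p))
    (D : Finset (Fin k → (Fin n → ZMod p))) (hD : D ⊆ cycleSet k X)
    (hdisj : ∀ c ∈ D, ∀ c' ∈ D, c ≠ c' → ∀ i, c i ≠ c' i)
    (hDcard : ε * (p : ℝ) ^ n ≤ (D.card : ℝ)) :
    δ * ((p : ℝ) ^ n) ^ (k - 1) ≤ ((cycleSet k X).card : ℝ) := by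
  have hcyc : cycleSet k X = cycles X := by
    ext x
    simp [cycleSet, cycles]
  rw [hcyc] at hD ⊢
  obtain ⟨κ, hκ, h⟩ := exists_cycleBound p hk
  have hpn : (0 : ℝ) < (p : ℝ) ^ n := pow_pos (by exact_mod_cast hp.out.pos) n
  have hne : D.Nonempty := Finset.card_pos.mp (by
    exact_mod_cast (mul_pos hε0 hpn).trans_le hDcard)
  have key := h.one hκ (Fin k) (Fin n → ZMod p) X D (Fintype.card_fin k) hD hdisj hne
  have hcard : (Fintype.card (Fin n → ZMod p) : ℝ) = (p : ℝ) ^ n := by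
    rw [Fintype.card_fun, ZMod.card, Fintype.card_fin, Nat.cast_pow]
  rw [hcard, one_mul] at key
  refine le_trans (mul_le_mul_of_nonneg_right ?_ (by positivity)) key
  have hC : 0 ≤ Cconst p k := by
    have h1 : (3 : ℝ) ≤ k := by exact_mod_cast hk
    have h2 : 0 ≤ ((k : ℝ) - 2) / cp3 p := div_nonneg (by linarith) (cp3_pos hp.out.two_le).le
    rw [Cconst]
    linarith
  rw [hδ]
  exact Real.rpow_le_rpow hε0.le ((le_div_iff₀ hpn).mpr hDcard) hC
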